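/- arXiv:2103.13848 — 2 statements merged into one kernel-verified Lean document; each statement's English description precedes it below -/
import Mathlib

section
/- Any embedded closed curve γ : S¹ → ℝⁿ of finite total curvature without cusps has an inscribed square-like quadrilateral: there exist four distinct points p,q,r,s on γ (in cyclic order) with ‖p-q‖=‖q-r‖=‖r-s‖=‖s-p‖ > 0 and ‖p-r‖=‖q-s‖. -/
noncomputable section

/-- Sum of the exterior turning angles of the polygonal path through the given
list of vertices. -/
def turnSum {n : ℕ} : List (EuclideanSpace ℝ (Fin n)) → ℝ
  | a :: b :: c :: rest =>
      InnerProductGeometry.angle (b - a) (c - b) + turnSum (b :: c :: rest)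
  | _ => 0

/-- For a closed curve given by a `1`-periodic map `γ : ℝ → ℝⁿ`, the set of
turning-angle sums of polygons inscribed in the open subarc `(a, b)`. -/
def arcTCSet {n : ℕ} (γ : ℝ → EuclideanSpace ℝ (Fin n)) (a b : ℝ) : Set ℝ :=
  {x | ∃ t : List ℝ, t.Chain' (· < ·) ∧ (∀ u ∈ t, u ∈ Set.Ioo a b) ∧
    x = turnSum (t.map γ)}

/-- The total curvature `κ(γ, a, b)` of the open subarc `(a, b)` of the closed
curve `γ`. -/
def arcTC {n : ℕ} (γ : ℝ → EuclideanSpace ℝ (Fin n)) (a b : ℝ) : ℝ :=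
  sSup (arcTCSet γ a b)

/-- The set of turning-angle sums of polygons inscribed in the closed curve
`γ`, with vertex parameters drawn from some window `[a, a+1]` of one period. -/
def circTCSet {n : ℕ} (γ : ℝ → EuclideanSpace ℝ (Fin n)) : Set ℝ :=
  {x | ∃ (a : ℝ) (t : List ℝ), t.Chain' (· < ·) ∧
    (∀ u ∈ t, u ∈ Set.Icc a (a + 1)) ∧ x = turnSum (t.map γ)}

/-- A closed curve has finite total curvature when the turning-angle sums of
its inscribed polygons are bounded above. -/
def FiniteTotalCurvature {n : ℕ} (γ : ℝ → EuclideanSpace ℝ (Fin n)) : Prop :=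
  BddAbove (circTCSet γ)

/-- The `π`-distance of a closed curve `γ`: the supremum of all `ℓ` such that
every open subarc of `γ` whose endpoints lie at distance less than `ℓ` has
total curvature less than `π`. -/
def piDist {n : ℕ} (γ : ℝ → EuclideanSpace ℝ (Fin n)) : ℝ :=
  sSup {ℓ : ℝ | ∀ a b : ℝ, a < b → b < a + 1 → ‖γ a - γ b‖ < ℓ →
    arcTC γ a b < Real.pi}

/-- Ordered simplicial chains modulo two: formal sums of lists of vertices. -/
abbrev ModTwoChain (α : Type*) := List α →₀ ZMod 2

namespace ModTwoChain

variable {α β : Type*}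

/-- The cone over a chain with apex `v`. -/
def cone (v : α) : ModTwoChain α →ₗ[ZMod 2] ModTwoChain α :=
  Finsupp.lmapDomain _ _ (List.cons v)

/-- The augmented boundary of a single simplex. -/
def bdryList : List α → ModTwoChain α
  | [] => 0
  | v :: l => Finsupp.single l 1 + cone v (bdryList l)

/-- The augmented boundary operator. -/
def bdry : ModTwoChain α →ₗ[ZMod 2] ModTwoChain α :=
  Finsupp.linearCombination (ZMod 2) bdryList

/-- The chain map induced by a map of vertices. -/
def map (f : α → β) : ModTwoChain α →ₗ[ZMod 2] ModTwoChain β :=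
  Finsupp.lmapDomain _ _ (List.map f)

/-- Evaluation of a cochain. -/
def eval (w : List α → ZMod 2) : ModTwoChain α →ₗ[ZMod 2] ZMod 2 :=
  Finsupp.linearCombination (ZMod 2) w

/-- Chains all of whose simplices lie in `S`. -/
abbrev supp (S : Set (List α)) : Submodule (ZMod 2) (ModTwoChain α) :=
  Finsupp.supported (ZMod 2) (ZMod 2) S

@[simp] lemma cone_single (v : α) (l : List α) (r : ZMod 2) :
    cone v (Finsupp.single l r) = Finsupp.single (v :: l) r := by
  simp [cone]

@[simp] lemma map_single (f : α → β) (l : List α) (r : ZMod 2) :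
    map f (Finsupp.single l r) = Finsupp.single (l.map f) r := by
  simp [map]

@[simp] lemma bdry_single (l : List α) :
    bdry (Finsupp.single l 1) = bdryList l := by
  simp [bdry]

@[simp] lemma eval_single (w : List α → ZMod 2) (l : List α) :
    eval w (Finsupp.single l 1) = w l := by
  simp [eval]

lemma add_self_eq_zero (c : ModTwoChain α) : c + c = 0 := by
  rw [← two_smul (ZMod 2) c, show (2 : ZMod 2) = 0 from rfl, zero_smul]

lemma bdry_cone (v : α) (c : ModTwoChain α) :
    bdry (cone v c) = c + cone v (bdry c) := by
  have : (bdry ∘ₗ cone v : ModTwoChain α →ₗ[ZMod 2] ModTwoChain α)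
      = LinearMap.id + cone v ∘ₗ bdry := by
    ext1 l
    ext1
    simp [bdryList]
  exact LinearMap.congr_fun this c

lemma bdry_bdryList (l : List α) : bdry (bdryList l) = 0 := by
  induction l with
  | nil => simp [bdryList]
  | cons v l ih => simp [bdryList, bdry_cone, ih, add_self_eq_zero]

lemma map_cone (f : α → β) (v : α) (c : ModTwoChain α) :
    map f (cone v c) = cone (f v) (map f c) := by
  have : (map f ∘ₗ cone v : ModTwoChain α →ₗ[ZMod 2] ModTwoChain β)
      = cone (f v) ∘ₗ map f := by
    ext1 l
    ext1
    simp
  exact LinearMap.congr_fun this c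

lemma map_bdryList (f : α → β) (l : List α) :
    map f (bdryList l) = bdryList (l.map f) := by
  induction l with
  | nil => simp [bdryList]
  | cons v l ih => simp [bdryList, map_cone, ih]

lemma linearCombination_mem {M : Type*} [AddCommGroup M] [Module (ZMod 2) M]
    {S : Set (List α)} {N : Submodule (ZMod 2) M} {f : List α → M}
    (hf : ∀ l ∈ S, f l ∈ N) {c : ModTwoChain α} (hc : c ∈ supp S) :
    Finsupp.linearCombination (ZMod 2) f c ∈ N := by
  rw [Finsupp.linearCombination_apply]
  exact Submodule.sum_mem _ fun l hl => N.smul_mem _ (hf l (hc hl))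

lemma linearMap_mem {M : Type*} [AddCommGroup M] [Module (ZMod 2) M]
    {S : Set (List α)} {N : Submodule (ZMod 2) M} (f : ModTwoChain α →ₗ[ZMod 2] M)
    (hf : ∀ l ∈ S, f (Finsupp.single l 1) ∈ N) {c : ModTwoChain α} (hc : c ∈ supp S) :
    f c ∈ N := by
  have : f = Finsupp.linearCombination (ZMod 2) fun l => f (Finsupp.single l 1) := by
    ext1 l
    ext1
    simp
  rw [this]
  exact linearCombination_mem hf hc

lemma linearMap_eq {M : Type*} [AddCommGroup M] [Module (ZMod 2) M]
    {S : Set (List α)} (f g : ModTwoChain α →ₗ[ZMod 2] M)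
    (hf : ∀ l ∈ S, f (Finsupp.single l 1) = g (Finsupp.single l 1))
    {c : ModTwoChain α} (hc : c ∈ supp S) : f c = g c := by
  have := linearMap_mem (N := ⊥) (f - g) (S := S)
    (fun l hl => by simp [hf l hl]) hc
  simpa [sub_eq_zero] using this

lemma bdryList_mem_supp (l : List α) :
    bdryList l ∈ supp {l' : List α | l'.length + 1 = l.length ∧ l' ⊆ l} := by
  induction l with
  | nil => simp [bdryList]
  | cons v l ih =>
    refine Submodule.add_mem _ (Finsupp.single_mem_supported _ _ (by simp)) ?_
    refine linearMap_mem (cone v) (fun l' hl' => ?_) ih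
    rw [cone_single]
    refine Finsupp.single_mem_supported _ _ ⟨by simpa using hl'.1, ?_⟩
    exact List.cons_subset_cons v hl'.2

section Subdivision

variable (b : List α → α)

/-- Subdivision of an `n`-vertex simplex with apex function `b`. -/
def sdList : ℕ → List α → ModTwoChain α
  | 0, _ => Finsupp.single [] 1
  | n + 1, l => cone (b l) (Finsupp.linearCombination (ZMod 2) (sdList n) (bdryList l))

/-- The subdivision operator with apex function `b`. -/
def sd : ModTwoChain α →ₗ[ZMod 2] ModTwoChain α :=
  Finsupp.linearCombination (ZMod 2) fun l => sdList b l.length l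

@[simp] lemma sd_nil : sd b (Finsupp.single [] 1) = Finsupp.single [] 1 := by
  simp [sd, sdList]

lemma sd_single {l : List α} (hl : l ≠ []) :
    sd b (Finsupp.single l 1) = cone (b l) (sd b (bdryList l)) := by
  obtain ⟨n, hn⟩ : ∃ n, l.length = n + 1 :=
    Nat.exists_eq_succ_of_ne_zero (by simpa using hl)
  have : Finsupp.linearCombination (ZMod 2) (sdList b n) (bdryList l)
      = sd b (bdryList l) := by
    refine linearMap_eq _ _ (fun l' hl' => ?_) (bdryList_mem_supp l)
    have : l'.length = n := by have := hl'.1; omega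
    simp [sd, this]
  rw [← this]
  simp [sd, hn, sdList]

lemma bdry_sd_single (n : ℕ) : ∀ l : List α, l.length = n →
    bdry (sd b (Finsupp.single l 1)) = sd b (bdryList l) := by
  induction n with
  | zero =>
    intro l hl
    obtain rfl : l = [] := by simpa using hl
    simp [bdryList]
  | succ n ih =>
    intro l hl
    have hne : l ≠ [] := by rintro rfl; simp at hl
    have key : bdry (sd b (bdryList l)) = sd b (bdry (bdryList l)) := by
      refine linearMap_eq (bdry ∘ₗ sd b) (sd b ∘ₗ bdry) (fun l' hl' => ?_)
        (bdryList_mem_supp l)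
      have : l'.length = n := by have := hl'.1; omega
      simpa using ih l' this
    rw [sd_single b hne, bdry_cone, key, bdry_bdryList]
    simp

lemma bdry_sd (c : ModTwoChain α) : bdry (sd b c) = sd b (bdry c) := by
  have : (bdry ∘ₗ sd b : ModTwoChain α →ₗ[ZMod 2] ModTwoChain α) = sd b ∘ₗ bdry := by
    ext1 l
    ext1
    simpa using bdry_sd_single b _ l rfl
  exact LinearMap.congr_fun this c

lemma bdry_sd_iterate (m : ℕ) (c : ModTwoChain α) :
    bdry ((sd b)^[m] c) = (sd b)^[m] (bdry c) := by
  induction m generalizing c with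
  | zero => rfl
  | succ m ih => simp [Function.iterate_succ_apply, ih, bdry_sd]

lemma map_sd_single (f : α → α) (hf : ∀ l, l ≠ [] → b (l.map f) = f (b l)) (n : ℕ) :
    ∀ l : List α, l.length = n →
      map f (sd b (Finsupp.single l 1)) = sd b (Finsupp.single (l.map f) 1) := by
  induction n with
  | zero =>
    intro l hl
    obtain rfl : l = [] := by simpa using hl
    simp
  | succ n ih =>
    intro l hl
    have hne : l ≠ [] := by rintro rfl; simp at hl
    rw [sd_single b hne, sd_single b (by simpa using hne), map_cone, hf l hne,
      ← map_bdryList]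
    congr 1
    refine linearMap_eq (map f ∘ₗ sd b) (sd b ∘ₗ map f) (fun l' hl' => ?_)
      (bdryList_mem_supp l)
    have : l'.length = n := by have := hl'.1; omega
    simpa using ih l' this

lemma map_sd_iterate (f : α → α) (hf : ∀ l, l ≠ [] → b (l.map f) = f (b l)) (m : ℕ)
    (c : ModTwoChain α) : map f ((sd b)^[m] c) = (sd b)^[m] (map f c) := by
  have : (map f ∘ₗ sd b : ModTwoChain α →ₗ[ZMod 2] ModTwoChain α) = sd b ∘ₗ map f := by
    ext1 l
    ext1
    simpa using map_sd_single b f hf _ l rfl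
  have h (c : ModTwoChain α) : map f (sd b c) = sd b (map f c) :=
    LinearMap.congr_fun this c
  induction m generalizing c with
  | zero => rfl
  | succ m ih => simp [Function.iterate_succ_apply, ih, h]

/-- The vertices of `l'` lie in every set that contains the vertices of `l` and is closed
under the apex function `b`. -/
def InHull (l l' : List α) : Prop :=
  ∀ K : Set α, (∀ l, l ≠ [] → (∀ p ∈ l, p ∈ K) → b l ∈ K) → (∀ p ∈ l, p ∈ K) →
    ∀ p ∈ l', p ∈ K

/-- A predicate preserved by coning off is inherited by the simplices of a subdivision. -/
lemma sd_single_mem {P Q : List α → Prop} (hnil : Q [])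
    (hface : ∀ l l', P l → l' ⊆ l → l'.length + 1 = l.length → P l')
    (hcone : ∀ l l', P l → l ≠ [] → Q l' → InHull b l l' → Q (b l :: l')) (n : ℕ) :
    ∀ l : List α, P l → l.length = n →
      sd b (Finsupp.single l 1) ∈ supp {l' | Q l' ∧ l'.length = n ∧ InHull b l l'} := by
  induction n with
  | zero =>
    intro l _ hl
    obtain rfl : l = [] := by simpa using hl
    rw [sd_nil]
    exact Finsupp.single_mem_supported _ _ ⟨hnil, rfl, by simp [InHull]⟩
  | succ n ih =>
    intro l hP hl
    have hne : l ≠ [] := by rintro rfl; simp at hl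
    rw [sd_single b hne]
    refine linearMap_mem (S := {l' | Q l' ∧ l'.length = n ∧ InHull b l l'}) (cone (b l))
      (fun l' hl' => ?_) ?_
    · obtain ⟨h1, h2, h3⟩ := hl'
      rw [cone_single]
      refine Finsupp.single_mem_supported _ _
        ⟨hcone l l' hP hne h1 h3, by simp [h2], fun K hK hlK p hp => ?_⟩
      rcases List.mem_cons.1 hp with rfl | hp
      · exact hK l hne hlK
      · exact h3 K hK hlK p hp
    · refine linearMap_mem (sd b) (fun l' hl' => ?_) (bdryList_mem_supp l)
      refine Finsupp.supported_mono ?_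
        (ih l' (hface l l' hP hl'.2 hl'.1) (by have := hl'.1; omega))
      rintro m ⟨h1, h2, h3⟩
      exact ⟨h1, h2, fun K hK hlK => h3 K hK fun p hp => hlK p (hl'.2 hp)⟩

end Subdivision

end ModTwoChain

section Barycenter

variable {E : Type*} [NormedAddCommGroup E] [NormedSpace ℝ E]

/-- The barycenter of a list of points. -/
def listBarycenter (l : List E) : E := (l.length : ℝ)⁻¹ • l.sum

lemma Convex.listBarycenter_mem {K : Set E} (hK : Convex ℝ K) {l : List E} (hne : l ≠ [])
    (hl : ∀ p ∈ l, p ∈ K) : listBarycenter l ∈ K := by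
  have hn : (l.length : ℝ) ≠ 0 := by simpa using hne
  have hsum : l.sum = ∑ i : Fin l.length, l.get i := by
    rw [← List.sum_ofFn, List.ofFn_get]
  rw [listBarycenter, hsum, Finset.smul_sum]
  refine hK.sum_mem (fun i _ => by positivity) ?_ fun i _ => hl _ (List.get_mem l i)
  simp [hn]

lemma norm_sum_sub_le {D : ℝ} (v : E) (l : List E) (hl : ∀ u ∈ l, dist u v ≤ D) :
    ‖l.sum - (l.length : ℝ) • v‖ ≤ l.length * D := by
  induction l with
  | nil => simp
  | cons u l ih =>
    have h1 := ih fun u hu => hl u (List.mem_cons_of_mem _ hu)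
    have h2 := hl u List.mem_cons_self
    rw [dist_eq_norm] at h2
    have : (u :: l).sum - ((u :: l).length : ℝ) • v
        = (u - v) + (l.sum - (l.length : ℝ) • v) := by
      simp only [List.sum_cons, List.length_cons, Nat.cast_add, Nat.cast_one, add_smul, one_smul]
      abel
    rw [this]
    refine (norm_add_le _ _).trans ?_
    simp only [List.length_cons, Nat.cast_add, Nat.cast_one]
    linarith

lemma norm_sum_sub_le_of_mem {D : ℝ} (v : E) (l : List E) (hv : v ∈ l)
    (hl : ∀ u ∈ l, dist u v ≤ D) :
    ‖l.sum - (l.length : ℝ) • v‖ ≤ (l.length - 1) * D := by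
  obtain ⟨l₁, l₂, rfl⟩ := List.append_of_mem hv
  have := norm_sum_sub_le v (l₁ ++ l₂) fun u hu => hl u (by
    rcases List.mem_append.1 hu with h | h <;> simp [h])
  have h3 : (l₁ ++ v :: l₂).sum - ((l₁ ++ v :: l₂).length : ℝ) • v
      = (l₁ ++ l₂).sum - ((l₁ ++ l₂).length : ℝ) • v := by
    simp only [List.sum_append, List.sum_cons, List.length_append, List.length_cons,
      Nat.cast_add, Nat.cast_one, add_smul, one_smul]
    abel
  rw [h3]
  refine this.trans (le_of_eq ?_)
  simp only [List.length_append, List.length_cons]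
  push_cast
  ring

lemma dist_listBarycenter_le {D : ℝ} {l : List E} {N : ℕ} (hlen : l.length ≤ N) {v : E}
    (hv : v ∈ l) (hl : ∀ u ∈ l, dist u v ≤ D) :
    dist v (listBarycenter l) ≤ (1 - (N : ℝ)⁻¹) * D := by
  have hD : 0 ≤ D := by simpa using hl v hv
  have hpos : 0 < (l.length : ℝ) := by exact_mod_cast List.length_pos_of_mem hv
  have hN : (l.length : ℝ) ≤ N := by exact_mod_cast hlen
  have key := norm_sum_sub_le_of_mem v l hv hl
  have : listBarycenter l - v = (l.length : ℝ)⁻¹ • (l.sum - (l.length : ℝ) • v) := by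
    rw [listBarycenter, smul_sub, smul_smul, inv_mul_cancel₀ hpos.ne', one_smul]
  rw [dist_comm, dist_eq_norm, this, norm_smul, norm_inv, Real.norm_of_nonneg hpos.le]
  calc (l.length : ℝ)⁻¹ * ‖l.sum - (l.length : ℝ) • v‖
      ≤ (l.length : ℝ)⁻¹ * ((l.length - 1) * D) := by gcongr
    _ = (1 - (l.length : ℝ)⁻¹) * D := by field_simp
    _ ≤ (1 - (N : ℝ)⁻¹) * D := by gcongr

namespace ModTwoChain

/-- Iterated barycentric subdivision keeps simplices in convex sets and shrinks their
diameter geometrically. -/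
lemma sd_listBarycenter_iterate_mem {K : Set E} (hK : Convex ℝ K) {N n : ℕ} (hn : n ≤ N)
    {D : ℝ} {l : List E} (hlen : l.length = n) (hlK : ∀ p ∈ l, p ∈ K)
    (hD : ∀ p ∈ l, ∀ q ∈ l, dist p q ≤ D) (m : ℕ) :
    (sd listBarycenter)^[m] (Finsupp.single l 1) ∈ supp {l' | l'.length = n ∧
      (∀ p ∈ l', p ∈ K) ∧ ∀ p ∈ l', ∀ q ∈ l', dist p q ≤ (1 - (N : ℝ)⁻¹) ^ m * D} := by
  induction m with
  | zero =>
    refine Finsupp.single_mem_supported _ _ ⟨hlen, hlK, by simpa using hD⟩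
  | succ m ih =>
    rw [Function.iterate_succ_apply']
    refine linearMap_mem (sd listBarycenter) (fun l' hl' => ?_) ih
    obtain ⟨h1, h2, h3⟩ := hl'
    set D' := (1 - (N : ℝ)⁻¹) ^ m * D with hD'
    have hsd := sd_single_mem listBarycenter
      (P := fun l => l.length ≤ N ∧ ∀ p ∈ l, ∀ q ∈ l, dist p q ≤ D')
      (Q := fun l => ∀ p ∈ l, ∀ q ∈ l, dist p q ≤ (1 - (N : ℝ)⁻¹) * D')
      (by simp)
      (fun l l' hl hsub hlen => ⟨by have := hl.1; omega,
        fun p hp q hq => hl.2 p (hsub hp) q (hsub hq)⟩)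
      (fun l l' hl hne hl' hinv => by
        have hdist : ∀ p ∈ l, dist p (listBarycenter l) ≤ (1 - (N : ℝ)⁻¹) * D' :=
          fun p hp => dist_listBarycenter_le hl.1 hp fun u hu => hl.2 u hu p hp
        have hball : ∀ p ∈ l', dist p (listBarycenter l) ≤ (1 - (N : ℝ)⁻¹) * D' :=
          hinv (Metric.closedBall (listBarycenter l) ((1 - (N : ℝ)⁻¹) * D'))
            (fun l hl hl' => (convex_closedBall _ _).listBarycenter_mem hl hl') hdist
        obtain ⟨v, hv⟩ := List.exists_mem_of_ne_nil l hne
        have hnn := dist_nonneg.trans (hdist v hv)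
        intro p hp q hq
        rcases List.mem_cons.1 hp with rfl | hp
        · rcases List.mem_cons.1 hq with rfl | hq
          · simpa using hnn
          · simpa [dist_comm] using hball q hq
        · rcases List.mem_cons.1 hq with rfl | hq
          · exact hball p hp
          · exact hl' p hp q hq)
      n l' ⟨by omega, h3⟩ h1
    refine Finsupp.supported_mono ?_ hsd
    rintro l'' ⟨g1, g2, g3⟩
    refine ⟨g2, g3 K (fun l hl hl' => hK.listBarycenter_mem hl hl') h2, fun p hp q hq => ?_⟩
    rw [pow_succ', mul_assoc]
    exact g1 p hp q hq

end ModTwoChain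

end Barycenter

section OrderedQuadruples

open ModTwoChain

/-- The cyclic shift of a quadruple of parameters on a circle of length one. -/
def rotQuad (p : Fin 4 → ℝ) : Fin 4 → ℝ := ![p 1, p 2, p 3, p 0 + 1]

/-- Ordered quadruples of parameters in the unit interval. -/
def orderedQuads : Set (Fin 4 → ℝ) :=
  {p | 0 ≤ p 0 ∧ p 0 ≤ p 1 ∧ p 1 ≤ p 2 ∧ p 2 ≤ p 3 ∧ p 3 ≤ 1}

lemma mem_Icc_of_mem_orderedQuads {p : Fin 4 → ℝ} (hp : p ∈ orderedQuads) (i : Fin 4) :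
    p i ∈ Set.Icc (0 : ℝ) 1 := by
  obtain ⟨h0, h1, h2, h3, h4⟩ := hp
  fin_cases i <;> constructor <;> simp <;> linarith

lemma dist_le_one_of_mem_orderedQuads {p q : Fin 4 → ℝ} (hp : p ∈ orderedQuads)
    (hq : q ∈ orderedQuads) : dist p q ≤ 1 := by
  refine (dist_pi_le_iff zero_le_one).2 fun i => ?_
  have h1 := mem_Icc_of_mem_orderedQuads hp i
  have h2 := mem_Icc_of_mem_orderedQuads hq i
  rw [Real.dist_eq, abs_le]
  constructor <;> linarith [h1.1, h1.2, h2.1, h2.2]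

lemma convex_orderedQuads : Convex ℝ orderedQuads := by
  rintro p ⟨h0, h1, h2, h3, h4⟩ q ⟨k0, k1, k2, k3, k4⟩ a b ha hb hab
  refine ⟨?_, ?_, ?_, ?_, ?_⟩ <;> simp only [Pi.add_apply, Pi.smul_apply, smul_eq_mul]
  · positivity
  · gcongr
  · gcongr
  · gcongr
  · nlinarith

lemma convex_setOf_eq_affine (f g : (Fin 4 → ℝ) →ₗ[ℝ] ℝ) (c : ℝ) :
    Convex ℝ {p | f p = g p + c} := by
  intro p hp q hq a b _ _ hab
  simp only [Set.mem_ofPred_eq, map_add, map_smul, smul_eq_mul] at *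
  rw [hp, hq]
  linear_combination c * hab

lemma convex_setOf_apply_eq (i j : Fin 4) : Convex ℝ {p : Fin 4 → ℝ | p i = p j} := by
  simpa using convex_setOf_eq_affine (LinearMap.proj i) (LinearMap.proj j) 0

lemma convex_setOf_apply_eq_const (i : Fin 4) (c : ℝ) :
    Convex ℝ {p : Fin 4 → ℝ | p i = c} := by
  simpa using convex_setOf_eq_affine (LinearMap.proj i) 0 c

lemma sum_map_rotQuad (l : List (Fin 4 → ℝ)) :
    (l.map rotQuad).sum = ![l.sum 1, l.sum 2, l.sum 3, l.sum 0 + l.length] := by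
  induction l with
  | nil => ext i; fin_cases i <;> simp
  | cons p l ih =>
    rw [List.map_cons, List.sum_cons, ih]
    ext i
    fin_cases i <;> simp [rotQuad]
    ring

lemma listBarycenter_map_rotQuad (l : List (Fin 4 → ℝ)) (hl : l ≠ []) :
    listBarycenter (l.map rotQuad) = rotQuad (listBarycenter l) := by
  have hn : (l.length : ℝ) ≠ 0 := by simpa using hl
  rw [listBarycenter, sum_map_rotQuad]
  ext i
  fin_cases i <;> simp [rotQuad, listBarycenter]
  field_simp

/-- Indicator of the lists of labels that enumerate `s`. -/
def permWeight (s l : List (Fin 4)) : ZMod 2 := if l.Perm s then 1 else 0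

lemma permWeight_bdryList_five (l : List (Fin 4)) (hl : l.length = 5) :
    ModTwoChain.eval (permWeight [0, 1, 2, 3]) (bdryList l) = 0 := by
  match l, hl with
  | [a, b, c, d, e], _ =>
    simp only [bdryList, map_add, cone_single, map_zero, add_zero, eval_single]
    revert a b c d e
    decide

lemma permWeight_bdryList_four (l : List (Fin 4)) (hl : l.length = 4) :
    ModTwoChain.eval (permWeight [0, 1, 2]) (bdryList l) = permWeight [0, 1, 2, 3] l := by
  match l, hl with
  | [a, b, c, d], _ =>
    simp only [bdryList, map_add, cone_single, map_zero, add_zero, eval_single]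
    revert a b c d
    decide

lemma permWeight_bdryList_three (l : List (Fin 4)) (hl : l.length = 3)
    (h : ∀ i ∈ l, i ≠ 3) :
    ModTwoChain.eval (permWeight [0, 1]) (bdryList l) = permWeight [0, 1, 2] l := by
  match l, hl with
  | [a, b, c], _ =>
    simp only [bdryList, map_add, cone_single, map_zero, add_zero, eval_single]
    revert a b c
    decide

lemma permWeight_bdryList_two (l : List (Fin 4)) (hl : l.length = 2)
    (h : ∀ i ∈ l, i ≠ 3 ∧ i ≠ 2) :
    ModTwoChain.eval (permWeight [0]) (bdryList l) = permWeight [0, 1] l := by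
  match l, hl with
  | [a, b], _ =>
    simp only [bdryList, map_add, cone_single, map_zero, add_zero, eval_single]
    revert a b
    decide

lemma permWeight_bdryList_one (l : List (Fin 4)) (hl : l.length = 1)
    (h : ∀ i ∈ l, i ≠ 3 ∧ i ≠ 2 ∧ i ≠ 1) :
    ModTwoChain.eval (permWeight []) (bdryList l) = permWeight [0] l := by
  match l, hl with
  | [a], _ =>
    simp only [bdryList, map_zero, add_zero, eval_single]
    revert a
    decide

/-- The `m`-th barycentric subdivision of a simplex. -/
def sdPow (m : ℕ) (l : List (Fin 4 → ℝ)) : ModTwoChain (Fin 4 → ℝ) :=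
  (sd listBarycenter)^[m] (Finsupp.single l 1)

lemma sd_iterate_single (m : ℕ) (l : List (Fin 4 → ℝ)) :
    (sd listBarycenter)^[m] (Finsupp.single l 1) = sdPow m l := rfl

lemma sdPow_nil (m : ℕ) : sdPow m [] = Finsupp.single [] 1 := by
  induction m with
  | zero => rfl
  | succ m ih => rw [sdPow, Function.iterate_succ_apply, sd_nil]; exact ih

lemma sdPow_mem {K : Set (Fin 4 → ℝ)} (hK : Convex ℝ K) (hKT : K ⊆ orderedQuads)
    {l : List (Fin 4 → ℝ)} (hlen : l.length ≤ 5) (hl : ∀ p ∈ l, p ∈ K) (m : ℕ) :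
    sdPow m l ∈ supp {l' | l'.length = l.length ∧ (∀ p ∈ l', p ∈ K) ∧
      ∀ p ∈ l', ∀ q ∈ l', dist p q ≤ (4 / 5 : ℝ) ^ m} := by
  have := sd_listBarycenter_iterate_mem hK hlen rfl hl (D := 1)
    (fun p hp q hq => dist_le_one_of_mem_orderedQuads (hKT (hl p hp)) (hKT (hl q hq))) m
  norm_num at this
  exact this

lemma bdry_sdPow (m : ℕ) (l : List (Fin 4 → ℝ)) :
    bdry (sdPow m l) = (sd listBarycenter)^[m] (bdryList l) := by
  simp [sdPow, bdry_sd_iterate]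

lemma sd_iterate_add (m : ℕ) (c c' : ModTwoChain (Fin 4 → ℝ)) :
    (sd listBarycenter)^[m] (c + c')
      = (sd listBarycenter)^[m] c + (sd listBarycenter)^[m] c' :=
  iterate_map_add _ _ _ _

/-- The indicator of the simplices whose vertices are labelled by `s`. -/
def labelWeight (lab : (Fin 4 → ℝ) → Fin 4) (s : List (Fin 4)) (l : List (Fin 4 → ℝ)) :
    ZMod 2 :=
  permWeight s (l.map lab)

lemma eval_map {α β : Type*} (f : α → β) (w : List β → ZMod 2) (c : ModTwoChain α) :
    ModTwoChain.eval w (ModTwoChain.map f c)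
      = ModTwoChain.eval (fun l => w (l.map f)) c := by
  have : (ModTwoChain.eval w ∘ₗ ModTwoChain.map f) = ModTwoChain.eval (fun l => w (l.map f)) := by
    ext1 l
    ext1
    simp
  exact LinearMap.congr_fun this c

lemma eval_eq_zero {α : Type*} {w : List α → ZMod 2} {S : Set (List α)}
    (hw : ∀ l ∈ S, w l = 0) {c : ModTwoChain α} (hc : c ∈ supp S) :
    ModTwoChain.eval w c = 0 :=
  linearMap_eq (ModTwoChain.eval w) 0 (fun l hl => by simpa using hw l hl) hc

lemma eval_labelWeight_sdPow_eq_zero {lab : (Fin 4 → ℝ) → Fin 4} {s : List (Fin 4)}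
    {i : Fin 4} (hi : i ∈ s) {K : Set (Fin 4 → ℝ)} (hK : Convex ℝ K)
    (hKT : K ⊆ orderedQuads) (hlab : ∀ p ∈ K, lab p ≠ i)
    {l : List (Fin 4 → ℝ)} (hlen : l.length ≤ 5) (hl : ∀ p ∈ l, p ∈ K) (m : ℕ) :
    ModTwoChain.eval (labelWeight lab s) (sdPow m l) = 0 := by
  refine eval_eq_zero (fun l' hl' => ?_) (sdPow_mem hK hKT hlen hl m)
  refine if_neg fun hperm => ?_
  obtain ⟨p, hp, rfl⟩ := List.mem_map.1 (hperm.mem_iff.2 hi)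
  exact hlab p (hl'.2.1 p hp) rfl

lemma eval_labelWeight_bdry {lab : (Fin 4 → ℝ) → Fin 4} {s s' : List (Fin 4)}
    {K : Set (Fin 4 → ℝ)} (hK : Convex ℝ K) (hKT : K ⊆ orderedQuads)
    {l : List (Fin 4 → ℝ)} (hlen : l.length ≤ 5) (hl : ∀ p ∈ l, p ∈ K)
    (h : ∀ l' : List (Fin 4), l'.length = l.length → (∀ i ∈ l', ∃ p ∈ K, lab p = i) →
      ModTwoChain.eval (permWeight s) (bdryList l') = permWeight s' l') (m : ℕ) :
    ModTwoChain.eval (labelWeight lab s) (bdry (sdPow m l))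
      = ModTwoChain.eval (labelWeight lab s') (sdPow m l) := by
  refine linearMap_eq (ModTwoChain.eval (labelWeight lab s) ∘ₗ bdry)
    (ModTwoChain.eval (labelWeight lab s')) (fun l' hl' => ?_) (sdPow_mem hK hKT hlen hl m)
  have h1 : _ = labelWeight lab s' l' := h (l'.map lab) (by simpa using hl'.1) (by
    intro i hi
    obtain ⟨p, hp, rfl⟩ := List.mem_map.1 hi
    exact ⟨p, hl'.2.1 p hp, rfl⟩)
  rw [← map_bdryList, eval_map] at h1
  change ModTwoChain.eval (labelWeight lab s) _ = _ at h1
  simpa using h1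

/-- Sperner's lemma for the face `p 0 = 0` of the simplex of ordered quadruples. -/
lemma eval_labelWeight_face (lab : (Fin 4 → ℝ) → Fin 4)
    (h0 : ∀ p ∈ orderedQuads, p 0 = p 1 → lab p ≠ 0)
    (h1 : ∀ p ∈ orderedQuads, p 1 = p 2 → lab p ≠ 1)
    (h2 : ∀ p ∈ orderedQuads, p 2 = p 3 → lab p ≠ 2)
    (h3 : ∀ p ∈ orderedQuads, p 0 = 0 → p 3 = 1 → lab p ≠ 3) (m : ℕ) :
    ModTwoChain.eval (labelWeight lab [0, 1, 2, 3])
      (sdPow m [![0, 0, 0, 0], ![0, 0, 0, 1], ![0, 0, 1, 1], ![0, 1, 1, 1]]) = 1 := by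
  have hT := convex_orderedQuads
  have c0 := hT.inter (convex_setOf_apply_eq 0 1)
  have c1 := hT.inter (convex_setOf_apply_eq 1 2)
  have c2 := hT.inter (convex_setOf_apply_eq 2 3)
  have c3 := (hT.inter (convex_setOf_apply_eq_const 0 0)).inter
    (convex_setOf_apply_eq_const 3 1)
  have c32 := c3.inter (convex_setOf_apply_eq 2 3)
  have c321 := c32.inter (convex_setOf_apply_eq 1 2)
  have z0 : ∀ p ∈ orderedQuads ∩ {p | p 0 = p 1}, lab p ≠ 0 := fun p hp => h0 p hp.1 hp.2
  have z1 : ∀ p ∈ orderedQuads ∩ {p | p 1 = p 2}, lab p ≠ 1 := fun p hp => h1 p hp.1 hp.2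
  have z2 : ∀ p ∈ orderedQuads ∩ {p | p 2 = p 3}, lab p ≠ 2 := fun p hp => h2 p hp.1 hp.2
  have e4 := eval_labelWeight_bdry (lab := lab) (s := [0, 1, 2]) (s' := [0, 1, 2, 3]) hT le_rfl
    (l := [![0, 0, 0, 0], ![0, 0, 0, 1], ![0, 0, 1, 1], ![0, 1, 1, 1]]) (by simp)
    (by simp [orderedQuads]) (fun l' hl' _ => permWeight_bdryList_four l' hl') m
  have e3 := eval_labelWeight_bdry (lab := lab) (s := [0, 1]) (s' := [0, 1, 2]) c3
    (fun p hp => hp.1.1) (l := [![0, 0, 0, 1], ![0, 0, 1, 1], ![0, 1, 1, 1]]) (by simp)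
    (by simp [orderedQuads]) (fun l' hl' hl => permWeight_bdryList_three l' hl' fun i hi => by
      obtain ⟨p, hp, rfl⟩ := hl i hi
      exact h3 p hp.1.1 hp.1.2 hp.2) m
  have e2 := eval_labelWeight_bdry (lab := lab) (s := [0]) (s' := [0, 1]) c32
    (fun p hp => hp.1.1.1) (l := [![0, 0, 1, 1], ![0, 1, 1, 1]]) (by simp)
    (by simp [orderedQuads]) (fun l' hl' hl => permWeight_bdryList_two l' hl' fun i hi => by
      obtain ⟨p, hp, rfl⟩ := hl i hi
      exact ⟨h3 p hp.1.1.1 hp.1.1.2 hp.1.2, h2 p hp.1.1.1 hp.2⟩) m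
  have e1 := eval_labelWeight_bdry (lab := lab) (s := []) (s' := [0]) c321
    (fun p hp => hp.1.1.1.1) (l := [![0, 1, 1, 1]]) (by simp)
    (by simp [orderedQuads]) (fun l' hl' hl => permWeight_bdryList_one l' hl' fun i hi => by
      obtain ⟨p, hp, rfl⟩ := hl i hi
      exact ⟨h3 p hp.1.1.1.1 hp.1.1.1.2 hp.1.1.2, h2 p hp.1.1.1.1 hp.1.2,
        h1 p hp.1.1.1.1 hp.2⟩) m
  have e0 : ModTwoChain.eval (labelWeight lab []) (sdPow m []) = 1 := by
    rw [sdPow_nil, eval_single]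
    rfl
  simp only [bdry_sdPow, bdryList, map_add, cone_single, map_zero, add_zero,
    sd_iterate_add, sd_iterate_single] at e4 e3 e2 e1
  rw [eval_labelWeight_sdPow_eq_zero (s := [0, 1, 2]) (i := 2) (by simp) c2 Set.inter_subset_left
      z2 (l := [![0, 0, 0, 0], ![0, 0, 1, 1], ![0, 1, 1, 1]]) (by simp) (by simp [orderedQuads]),
    eval_labelWeight_sdPow_eq_zero (s := [0, 1, 2]) (i := 1) (by simp) c1 Set.inter_subset_left
      z1 (l := [![0, 0, 0, 0], ![0, 0, 0, 1], ![0, 1, 1, 1]]) (by simp) (by simp [orderedQuads]),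
    eval_labelWeight_sdPow_eq_zero (s := [0, 1, 2]) (i := 0) (by simp) c0 Set.inter_subset_left
      z0 (l := [![0, 0, 0, 0], ![0, 0, 0, 1], ![0, 0, 1, 1]]) (by simp) (by simp [orderedQuads]),
    ← e3, eval_labelWeight_sdPow_eq_zero (s := [0, 1]) (i := 1) (by simp) c1 Set.inter_subset_left
      z1 (l := [![0, 0, 0, 1], ![0, 1, 1, 1]]) (by simp) (by simp [orderedQuads]),
    eval_labelWeight_sdPow_eq_zero (s := [0, 1]) (i := 0) (by simp) c0 Set.inter_subset_left
      z0 (l := [![0, 0, 0, 1], ![0, 0, 1, 1]]) (by simp) (by simp [orderedQuads]),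
    ← e2, eval_labelWeight_sdPow_eq_zero (s := [0]) (i := 0) (by simp) c0 Set.inter_subset_left
      z0 (l := [![0, 0, 1, 1]]) (by simp) (by simp [orderedQuads]), ← e1, e0] at e4
  rw [← e4]
  rfl

/-- A Sperner-type parity lemma: for a labelling of ordered quadruples which is compatible
with the cyclic shift, and a function changing sign under it, some small
fully labelled simplex meets both closed half-lines. -/
theorem exists_small_full_simplex (lab : (Fin 4 → ℝ) → Fin 4) (d : (Fin 4 → ℝ) → ℝ)
    (h0 : ∀ p ∈ orderedQuads, p 0 = p 1 → lab p ≠ 0)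
    (h1 : ∀ p ∈ orderedQuads, p 1 = p 2 → lab p ≠ 1)
    (h2 : ∀ p ∈ orderedQuads, p 2 = p 3 → lab p ≠ 2)
    (h3 : ∀ p ∈ orderedQuads, p 0 = 0 → p 3 = 1 → lab p ≠ 3)
    (hrot : ∀ p ∈ orderedQuads, p 0 = 0 → lab (rotQuad p) + 1 = lab p)
    (hd : ∀ p ∈ orderedQuads, p 0 = 0 → d (rotQuad p) = -d p)
    {η : ℝ} (hη : 0 < η) :
    ∃ l : List (Fin 4 → ℝ), (∀ p ∈ l, p ∈ orderedQuads) ∧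
      (∀ p ∈ l, ∀ q ∈ l, dist p q < η) ∧ (∀ i, ∃ p ∈ l, lab p = i) ∧
      (∃ p ∈ l, d p ≤ 0) ∧ ∃ p ∈ l, 0 ≤ d p := by
  classical
  by_contra! H
  obtain ⟨m, hm⟩ := exists_pow_lt_of_lt_one hη (show (4 / 5 : ℝ) < 1 by norm_num)
  have hT := convex_orderedQuads
  have c0 := hT.inter (convex_setOf_apply_eq 0 1)
  have c1 := hT.inter (convex_setOf_apply_eq 1 2)
  have c2 := hT.inter (convex_setOf_apply_eq 2 3)
  have cF := hT.inter (convex_setOf_apply_eq_const 0 0)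
  set full : List (Fin 4) := [0, 1, 2, 3] with hfull
  have mem_full : ∀ i : Fin 4, i ∈ full := by decide
  set wpos : List (Fin 4 → ℝ) → ZMod 2 :=
    fun l => if (l.map lab).Perm full ∧ ∀ p ∈ l, 0 < d p then 1 else 0 with hwpos
  set wneg : List (Fin 4 → ℝ) → ZMod 2 :=
    fun l => if (l.map lab).Perm full ∧ ∀ p ∈ l, d p < 0 then 1 else 0 with hwneg
  have dich : ∀ l : List (Fin 4 → ℝ), (∀ p ∈ l, p ∈ orderedQuads) →
      (∀ p ∈ l, ∀ q ∈ l, dist p q < η) → (∀ i, ∃ p ∈ l, lab p = i) →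
      (∀ p ∈ l, 0 < d p) ∨ ∀ p ∈ l, d p < 0 := by
    intro l hl hs hf
    by_cases hp : ∃ p ∈ l, d p ≤ 0
    · exact Or.inr (H l hl hs hf hp)
    · push Not at hp
      exact Or.inl hp
  have full_of : ∀ l l' : List (Fin 4 → ℝ), l' ⊆ l → (l'.map lab).Perm full →
      ∀ i, ∃ p ∈ l, lab p = i := by
    intro l l' hsub hperm i
    obtain ⟨p, hp, rfl⟩ := List.mem_map.1 (hperm.mem_iff.2 (mem_full i))
    exact ⟨p, hsub hp, rfl⟩
  have wpos_zero : ∀ {K : Set (Fin 4 → ℝ)} {i : Fin 4} (_ : Convex ℝ K)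
      (_ : K ⊆ orderedQuads) (_ : ∀ p ∈ K, lab p ≠ i) {l : List (Fin 4 → ℝ)}
      (_ : l.length ≤ 5) (_ : ∀ p ∈ l, p ∈ K),
      ModTwoChain.eval wpos (sdPow m l) = 0 := by
    intro K i hK hKT hlab l hlen hl
    refine eval_eq_zero (fun l' hl' => ?_) (sdPow_mem hK hKT hlen hl m)
    refine if_neg fun hperm => ?_
    obtain ⟨p, hp, hpi⟩ := full_of l' l' (List.Subset.refl _) hperm.1 i
    exact hlab p (hl'.2.1 p hp) hpi
  have bdry_zero : ModTwoChain.eval wpos (bdry (sdPow m [![0, 0, 0, 0], ![0, 0, 0, 1],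
      ![0, 0, 1, 1], ![0, 1, 1, 1], ![1, 1, 1, 1]])) = 0 := by
    refine linearMap_eq (ModTwoChain.eval wpos ∘ₗ bdry) 0 (fun l hl => ?_)
      (sdPow_mem hT le_rfl (by simp) (by simp [orderedQuads]) m)
    obtain ⟨hlen, hlT, hsmall⟩ := hl
    have hsmall' : ∀ p ∈ l, ∀ q ∈ l, dist p q < η := fun p hp q hq =>
      (hsmall p hp q hq).trans_lt hm
    simp only [LinearMap.comp_apply, bdry_single, LinearMap.zero_apply]
    by_cases hpos : ∀ p ∈ l, 0 < d p
    · have : ModTwoChain.eval wpos (bdryList l)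
          = ModTwoChain.eval (labelWeight lab full) (bdryList l) := by
        refine linearMap_eq _ _ (fun l' hl' => ?_) (bdryList_mem_supp l)
        have : ∀ p ∈ l', 0 < d p := fun p hp => hpos p (hl'.2 hp)
        simp [hwpos, labelWeight, permWeight, and_iff_left this]
      rw [this]
      have key := permWeight_bdryList_five (l.map lab) (by simpa using hlen)
      rw [← map_bdryList, eval_map] at key
      exact key
    · refine eval_eq_zero (fun l' hl' => if_neg ?_) (bdryList_mem_supp l)
      rintro ⟨hperm, hpos'⟩
      have hf := full_of l l' hl'.2 hperm
      rcases dich l hlT hsmall' hf with h | h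
      · exact hpos h
      · obtain ⟨p, hp, -⟩ := full_of l' l' (List.Subset.refl _) hperm 0
        exact lt_asymm (hpos' p hp) (h p (hl'.2 hp))
  simp only [bdry_sdPow, bdryList, map_add, cone_single, map_zero, add_zero,
    sd_iterate_add, sd_iterate_single] at bdry_zero
  rw [wpos_zero (l := [![0, 0, 0, 0], ![0, 0, 1, 1], ![0, 1, 1, 1], ![1, 1, 1, 1]]) c2
      Set.inter_subset_left (fun p hp => h2 p hp.1 hp.2) (by simp) (by simp [orderedQuads]),
    wpos_zero (l := [![0, 0, 0, 0], ![0, 0, 0, 1], ![0, 1, 1, 1], ![1, 1, 1, 1]]) c1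
      Set.inter_subset_left (fun p hp => h1 p hp.1 hp.2) (by simp) (by simp [orderedQuads]),
    wpos_zero (l := [![0, 0, 0, 0], ![0, 0, 0, 1], ![0, 0, 1, 1], ![1, 1, 1, 1]]) c0
      Set.inter_subset_left (fun p hp => h0 p hp.1 hp.2) (by simp) (by simp [orderedQuads]),
    zero_add, zero_add, zero_add] at bdry_zero
  set F : List (Fin 4 → ℝ) := [![0, 0, 0, 0], ![0, 0, 0, 1], ![0, 0, 1, 1], ![0, 1, 1, 1]]
    with hF
  have hmemF := sdPow_mem cF Set.inter_subset_left (l := F) (by simp [F])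
    (by simp [F, orderedQuads]) m
  have hmapF : [![0, 0, 0, 1], ![0, 0, 1, 1], ![0, 1, 1, 1], ![1, 1, 1, 1]]
      = F.map rotQuad := by
    simp [F, rotQuad]
  have hrotF : sdPow m (F.map rotQuad) = ModTwoChain.map rotQuad (sdPow m F) := by
    rw [sdPow, sdPow, map_sd_iterate _ _ listBarycenter_map_rotQuad, map_single]
  have hnegF : ModTwoChain.eval wpos (ModTwoChain.map rotQuad (sdPow m F))
      = ModTwoChain.eval wneg (sdPow m F) := by
    rw [eval_map]
    refine linearMap_eq _ _ (fun l hl => ?_) hmemF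
    rw [eval_single, eval_single]
    have hl2 := hl.2.1
    have e1 : ((l.map rotQuad).map lab).map (· + 1) = l.map lab := by
      rw [List.map_map, List.map_map]
      exact List.map_congr_left fun p hp => hrot p (hl2 p hp).1 (hl2 p hp).2
    have e2 : (full.map (· + 1)).Perm full := by decide
    have e3 : ((l.map rotQuad).map lab).Perm full ↔ (l.map lab).Perm full := by
      rw [← List.map_perm_map_iff (add_left_injective (1 : Fin 4)), e1]
      exact ⟨fun h => h.trans e2, fun h => h.trans e2.symm⟩
    have e4 : (∀ p ∈ l.map rotQuad, 0 < d p) ↔ ∀ p ∈ l, d p < 0 := by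
      simp only [List.forall_mem_map]
      refine forall₂_congr fun p hp => ?_
      rw [hd p (hl2 p hp).1 (hl2 p hp).2, neg_pos]
    simp only [hwpos, hwneg, e3, e4]
  have hsumF : ModTwoChain.eval (labelWeight lab full) (sdPow m F)
      = ModTwoChain.eval wpos (sdPow m F) + ModTwoChain.eval wneg (sdPow m F) := by
    refine linearMap_eq (ModTwoChain.eval (labelWeight lab full))
      (ModTwoChain.eval wpos + ModTwoChain.eval wneg) (fun l hl => ?_) hmemF
    simp only [LinearMap.add_apply, eval_single, hwpos, hwneg, labelWeight, permWeight]
    by_cases hperm : (l.map lab).Perm full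
    · have hf := full_of l l (List.Subset.refl _) hperm
      obtain ⟨p, hp, -⟩ := hf 0
      rcases dich l (fun p hp => (hl.2.1 p hp).1)
        (fun p hp q hq => (hl.2.2 p hp q hq).trans_lt hm) hf with h | h
      · have : ¬ ∀ p ∈ l, d p < 0 := fun h' => lt_asymm (h p hp) (h' p hp)
        simp only [hperm, true_and, if_pos h, if_neg this]; simp
      · have : ¬ ∀ p ∈ l, 0 < d p := fun h' => lt_asymm (h p hp) (h' p hp)
        simp only [hperm, true_and, if_pos h, if_neg this]; simp
    · simp [hperm]
  rw [eval_labelWeight_face lab h0 h1 h2 h3 m, ← hnegF, ← hrotF, ← hmapF] at hsumF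
  rw [add_comm] at hsumF
  exact one_ne_zero (hsumF.trans bdry_zero)

lemma isCompact_orderedQuads : IsCompact orderedQuads := by
  refine (isCompact_Icc (a := (0 : Fin 4 → ℝ)) (b := 1)).of_isClosed_subset ?_ fun p hp =>
    ⟨fun i => (mem_Icc_of_mem_orderedQuads hp i).1, fun i => (mem_Icc_of_mem_orderedQuads hp i).2⟩
  have h : ∀ i, Continuous fun p : Fin 4 → ℝ => p i := continuous_apply
  exact (isClosed_le continuous_const (h 0)).inter <| (isClosed_le (h 0) (h 1)).inter <|
    (isClosed_le (h 1) (h 2)).inter <| (isClosed_le (h 2) (h 3)).inter <|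
    isClosed_le (h 3) continuous_const

/-- The inverse of the cyclic shift `rotQuad`. -/
def unrotQuad (p : Fin 4 → ℝ) : Fin 4 → ℝ := ![p 3 - 1, p 0, p 1, p 2]

lemma unrotQuad_rotQuad (p : Fin 4 → ℝ) : unrotQuad (rotQuad p) = p := by
  ext i; fin_cases i <;> simp [unrotQuad, rotQuad]

lemma rotQuad_unrotQuad (p : Fin 4 → ℝ) : rotQuad (unrotQuad p) = p := by
  ext i; fin_cases i <;> simp [unrotQuad, rotQuad]

/-- A cyclically equivariant family of four functions has a labelling by indices of maximal
functions which is compatible with the cyclic shift. -/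
lemma exists_equivariant_argmax (s : (Fin 4 → ℝ) → Fin 4 → ℝ)
    (hs : ∀ p i, s (rotQuad p) i = s p (i + 1)) :
    ∃ lab : (Fin 4 → ℝ) → Fin 4, (∀ p j, s p j ≤ s p (lab p)) ∧
      ∀ p ∈ orderedQuads, p 0 = 0 → lab (rotQuad p) + 1 = lab p := by
  have hs' : ∀ p i, s (unrotQuad p) i = s p (i - 1) := fun p i => by
    conv_rhs => rw [← rotQuad_unrotQuad p, hs, sub_add_cancel]
  choose L hL using fun p => Finite.exists_max (s p)
  have shift : ∀ p k, (∀ j, s (unrotQuad p) j ≤ s (unrotQuad p) k) →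
      ∀ j, s p j ≤ s p (k - 1) := fun p k h j => by
    simpa [hs'] using h (j + 1)
  refine ⟨fun p => if p 3 < 1 then L p else if p 2 < 1 then L (unrotQuad p) - 1 else
    if p 1 < 1 then L (unrotQuad (unrotQuad p)) - 1 - 1 else
    if p 0 < 1 then L (unrotQuad (unrotQuad (unrotQuad p))) - 1 - 1 - 1 else
    L (unrotQuad (unrotQuad (unrotQuad (unrotQuad p)))) - 1 - 1 - 1 - 1, fun p => ?_,
    fun p hp h0 => ?_⟩
  · dsimp only
    split_ifs
    · exact hL p
    · exact shift _ _ (hL _)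
    · exact shift _ _ (shift _ _ (hL _))
    · exact shift _ _ (shift _ _ (shift _ _ (hL _)))
    · exact shift _ _ (shift _ _ (shift _ _ (shift _ _ (hL _))))
  · have r0 : rotQuad p 0 = p 1 := rfl
    have r1 : rotQuad p 1 = p 2 := rfl
    have r2 : rotQuad p 2 = p 3 := rfl
    have r3 : ¬ rotQuad p 3 < 1 := by simp [rotQuad, h0]
    simp only [r0, r1, r2, r3, unrotQuad_rotQuad, if_false]
    obtain ⟨-, h1, h2, h3, h4⟩ := hp
    by_cases c3 : p 3 < 1
    · simp [c3]
    by_cases c2 : p 2 < 1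
    · simp [c3, c2]
    by_cases c1 : p 1 < 1
    · simp [c3, c2, c1]
    · simp [c3, c2, c1, h0]

/-- A cyclically equivariant family of four functions and an odd function on quadruples of points
of the circle have a common zero of the differences, provided the functions vanish where the
corresponding neighbouring points collide, and never all vanish. -/
lemma exists_forall_eq_and_eq_zero (s : (Fin 4 → ℝ) → Fin 4 → ℝ) (d : (Fin 4 → ℝ) → ℝ)
    (hsc : Continuous s) (hdc : Continuous d)
    (hs : ∀ p i, s (rotQuad p) i = s p (i + 1)) (hd : ∀ p, d (rotQuad p) = -d p)
    (hpos : ∀ p ∈ orderedQuads, ∃ i, 0 < s p i)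
    (h0 : ∀ p ∈ orderedQuads, p 0 = p 1 → s p 0 = 0)
    (h1 : ∀ p ∈ orderedQuads, p 1 = p 2 → s p 1 = 0)
    (h2 : ∀ p ∈ orderedQuads, p 2 = p 3 → s p 2 = 0)
    (h3 : ∀ p ∈ orderedQuads, p 0 = 0 → p 3 = 1 → s p 3 = 0) :
    ∃ p ∈ orderedQuads, (∀ i j, s p i = s p j) ∧ d p = 0 := by
  obtain ⟨lab, hlab, hrot⟩ := exists_equivariant_argmax s hs
  have hne : ∀ p ∈ orderedQuads, ∀ i, s p i = 0 → lab p ≠ i := by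
    rintro p hp _ hi rfl
    obtain ⟨j, hj⟩ := hpos p hp
    linarith [hlab p j]
  set G : (Fin 4 → ℝ) → ℝ := fun p => (∑ i, ∑ j, |s p i - s p j|) + |d p| with hG
  have hsi : ∀ i, Continuous fun p => s p i := fun i => (continuous_apply i).comp hsc
  have hGc : Continuous G := by fun_prop
  have hGsum : ∀ p, 0 ≤ ∑ i, ∑ j, |s p i - s p j| := fun p =>
    Finset.sum_nonneg fun i _ => Finset.sum_nonneg fun j _ => abs_nonneg _
  obtain ⟨q, hq, hmin⟩ := isCompact_orderedQuads.exists_isMinOn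
    ⟨0, by simp [orderedQuads]⟩ hGc.continuousOn
  refine ⟨q, hq, ?_⟩
  rcases (add_nonneg (hGsum q) (abs_nonneg (d q))).eq_or_lt with hz | hz
  · have hd0 : |d q| = 0 := by linarith [hGsum q, abs_nonneg (d q)]
    have hs0 : ∑ i, ∑ j, |s q i - s q j| = 0 := by linarith
    rw [Finset.sum_eq_zero_iff_of_nonneg
      fun i _ => Finset.sum_nonneg fun j _ => abs_nonneg _] at hs0
    refine ⟨fun i j => ?_, abs_eq_zero.1 hd0⟩
    have := (Finset.sum_eq_zero_iff_of_nonneg fun j _ => abs_nonneg _).1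
      (hs0 i (Finset.mem_univ i)) j (Finset.mem_univ j)
    exact sub_eq_zero.1 (abs_eq_zero.1 this)
  exfalso
  set δ := G q / 100 with hδ
  have hGq : 0 < G q := hz
  have hδ0 : 0 < δ := by positivity
  obtain ⟨η, hη, hunif⟩ := Metric.uniformContinuousOn_iff.1
    (isCompact_orderedQuads.uniformContinuousOn_of_continuous (hsc.prodMk hdc).continuousOn) δ hδ0
  obtain ⟨l, hl, hdiam, hfull, ⟨pn, hpn, hdn⟩, pp, hpp, hdp⟩ := exists_small_full_simplex lab d
    (fun p hp h => hne p hp 0 (h0 p hp h)) (fun p hp h => hne p hp 1 (h1 p hp h))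
    (fun p hp h => hne p hp 2 (h2 p hp h)) (fun p hp h h' => hne p hp 3 (h3 p hp h h'))
    hrot (fun p _ _ => hd p) hη
  obtain ⟨p, hp, -⟩ := hfull 0
  have hclose : ∀ r ∈ l, (∀ i, |s p i - s r i| < δ) ∧ |d p - d r| < δ := fun r hr => by
    have := hunif p (hl p hp) r (hl r hr) (hdiam p hp r hr)
    rw [Prod.dist_eq, max_lt_iff] at this
    exact ⟨fun i => (dist_le_pi_dist (s p) (s r) i).trans_lt this.1, this.2⟩
  have hle : ∀ i j, s p j - s p i ≤ 2 * δ := fun i j => by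
    obtain ⟨r, hr, hri⟩ := hfull i
    have hj := abs_lt.1 ((hclose r hr).1 j)
    have hi := abs_lt.1 ((hclose r hr).1 i)
    have := hlab r j
    rw [hri] at this
    linarith [hj.2, hi.1]
  have hdle : |d p| ≤ δ := by
    have hn := abs_lt.1 (hclose pn hpn).2
    have hp := abs_lt.1 (hclose pp hpp).2
    exact abs_le.2 ⟨by linarith [hp.1], by linarith [hn.2]⟩
  have hsum : ∑ i, ∑ j, |s p i - s p j| ≤ ∑ _i : Fin 4, ∑ _j : Fin 4, 2 * δ :=
    Finset.sum_le_sum fun i _ => Finset.sum_le_sum fun j _ =>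
      abs_le.2 ⟨by linarith [hle i j], hle j i⟩
  simp only [Finset.sum_const, Finset.card_univ, Fintype.card_fin, nsmul_eq_mul] at hsum
  have := hmin (hl p hp)
  change G q ≤ G p at this
  have hGp : G p = (∑ i, ∑ j, |s p i - s p j|) + |d p| := rfl
  norm_num at hsum
  linarith

end OrderedQuadruples

section InscribedQuadrilaterals

open InnerProductGeometry

/-- Three vectors of equal length which turn by less than `π` in total have a longer sum. -/
lemma lt_norm_add_add_of_angle_add_angle_lt_pi {V : Type*} [NormedAddCommGroup V]
    [InnerProductSpace ℝ V] {u v w : V} {r : ℝ} (hr : 0 < r) (hu : ‖u‖ = r) (hv : ‖v‖ = r)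
    (hw : ‖w‖ = r) (h : angle u v + angle v w < Real.pi) : r < ‖u + v + w‖ := by
  set α := angle u v with hα
  set β := angle v w with hβ
  have hα0 : 0 ≤ α := angle_nonneg u v
  have hβ0 : 0 ≤ β := angle_nonneg v w
  have hcos : Real.cos (α + β) ≤ Real.cos (angle u w) :=
    Real.cos_le_cos_of_nonneg_of_le_pi (angle_nonneg u w) h.le (angle_le_angle_add_angle u v w)
  have hsum : 0 < Real.cos α + Real.cos β + Real.cos (α + β) + 1 := by
    have e1 : Real.cos (α + β) = 2 * Real.cos ((α + β) / 2) ^ 2 - 1 := by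
      rw [← Real.cos_two_mul]; ring_nf
    have c1 : 0 < Real.cos ((α + β) / 2) :=
      Real.cos_pos_of_mem_Ioo ⟨by linarith [Real.pi_pos], by linarith⟩
    have c2 : 0 < Real.cos ((α - β) / 2) :=
      Real.cos_pos_of_mem_Ioo ⟨by linarith [Real.pi_pos], by linarith⟩
    rw [Real.cos_add_cos, e1]
    nlinarith [mul_pos c1 c1, mul_pos c1 c2]
  have huv := cos_angle_mul_norm_mul_norm u v
  have hvw := cos_angle_mul_norm_mul_norm v w
  have huw := cos_angle_mul_norm_mul_norm u w
  rw [hu, hv] at huv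
  rw [hv, hw] at hvw
  rw [hu, hw] at huw
  refine lt_of_pow_lt_pow_left₀ 2 (norm_nonneg _) ?_
  rw [norm_add_sq_real, norm_add_sq_real, inner_add_left, ← huv, ← hvw, ← huw, hu, hv, hw]
  nlinarith [mul_pos hr hr, mul_le_mul_of_nonneg_right hcos (mul_pos hr hr).le,
    mul_pos hsum (mul_pos hr hr)]

variable {n : ℕ} {γ : ℝ → EuclideanSpace ℝ (Fin n)}

lemma turnSum_le_arcTC (hftc : FiniteTotalCurvature γ) {a b : ℝ} (hab : b < a + 1) {t : List ℝ}
    (ht : t.IsChain (· < ·)) (hmem : ∀ u ∈ t, u ∈ Set.Ioo a b) :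
    turnSum (t.map γ) ≤ arcTC γ a b := by
  refine le_csSup (BddAbove.mono ?_ hftc) ⟨t, ht, hmem, rfl⟩
  rintro _ ⟨t, ht, hmem, rfl⟩
  exact ⟨a, t, ht, fun u hu => ⟨(hmem u hu).1.le, (hmem u hu).2.le.trans hab.le⟩, rfl⟩

/-- On an arc of total curvature less than `π`, the closing side of an inscribed quadrilateral
with three equal sides is longer than these sides. -/
lemma lt_norm_sub_of_arcTC_lt_pi (hftc : FiniteTotalCurvature γ) {a b : ℝ} (hab : b < a + 1)
    (htc : arcTC γ a b < Real.pi) {q : Fin 4 → ℝ} {r : ℝ} (hr : 0 < r)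
    (h01 : q 0 ≤ q 1) (h12 : q 1 ≤ q 2) (h23 : q 2 ≤ q 3) (hq : ∀ i, q i ∈ Set.Ioo a b)
    (hr0 : ‖γ (q 0) - γ (q 1)‖ = r) (hr1 : ‖γ (q 1) - γ (q 2)‖ = r)
    (hr2 : ‖γ (q 2) - γ (q 3)‖ = r) : r < ‖γ (q 3) - γ (q 0)‖ := by
  have hlt : ∀ {x y : ℝ}, x ≤ y → ‖γ x - γ y‖ = r → x < y := fun {x y} hxy h =>
    hxy.lt_of_ne fun e => by simp [e] at h; exact hr.ne h
  have hturn := turnSum_le_arcTC hftc hab (t := [q 0, q 1, q 2, q 3])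
    (by simp [hlt h01 hr0, hlt h12 hr1, hlt h23 hr2])
    (by simpa using ⟨hq 0, hq 1, hq 2, hq 3⟩)
  simp only [List.map_cons, List.map_nil, turnSum, add_zero] at hturn
  have := lt_norm_add_add_of_angle_add_angle_lt_pi hr (by rw [norm_sub_rev, hr0])
    (by rw [norm_sub_rev, hr1]) (by rw [norm_sub_rev, hr2]) (hturn.trans_lt htc)
  simpa using this

/-- The gaps between cyclically consecutive parameters. -/
def gap (p : Fin 4 → ℝ) : Fin 4 → ℝ := ![p 1 - p 0, p 2 - p 1, p 3 - p 2, p 0 + 1 - p 3]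

/-- The side lengths of an inscribed quadrilateral. -/
def side (γ : ℝ → EuclideanSpace ℝ (Fin n)) (p : Fin 4 → ℝ) : Fin 4 → ℝ :=
  ![‖γ (p 0) - γ (p 1)‖, ‖γ (p 1) - γ (p 2)‖, ‖γ (p 2) - γ (p 3)‖, ‖γ (p 3) - γ (p 0)‖]

/-- The difference of the diagonals of an inscribed quadrilateral. -/
def diagDiff (γ : ℝ → EuclideanSpace ℝ (Fin n)) (p : Fin 4 → ℝ) : ℝ :=
  ‖γ (p 0) - γ (p 2)‖ - ‖γ (p 1) - γ (p 3)‖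

/-- The side lengths of an inscribed quadrilateral, increased on sides which span nearly the
whole circle. -/
def penalizedSide (γ : ℝ → EuclideanSpace ℝ (Fin n)) (ε : ℝ) (p : Fin 4 → ℝ) (i : Fin 4) : ℝ :=
  side γ p i + max 0 (gap p i - (1 - ε))

lemma penalizedSide_of_gap_le {ε : ℝ} {p : Fin 4 → ℝ} {i : Fin 4} (h : gap p i ≤ 1 - ε) :
    penalizedSide γ ε p i = side γ p i := by
  rw [penalizedSide, max_eq_left (by linarith), add_zero]

lemma penalizedSide_rotQuad (hper : Function.Periodic γ 1) (ε : ℝ) (p : Fin 4 → ℝ) (i : Fin 4) :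
    penalizedSide γ ε (rotQuad p) i = penalizedSide γ ε p (i + 1) := by
  have hp := hper (p 0)
  fin_cases i <;> simp [penalizedSide, side, gap, rotQuad, hp]

lemma diagDiff_rotQuad (hper : Function.Periodic γ 1) (p : Fin 4 → ℝ) :
    diagDiff γ (rotQuad p) = -diagDiff γ p := by
  have hp := hper (p 0)
  simp [diagDiff, rotQuad, hp, norm_sub_rev (γ (p 2))]

lemma continuous_penalizedSide (hcont : Continuous γ) (ε : ℝ) :
    Continuous (penalizedSide γ ε) := by
  refine continuous_pi fun i => ?_
  fin_cases i <;> simp only [penalizedSide, side, gap] <;> simp <;> fun_prop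

lemma continuous_diagDiff (hcont : Continuous γ) : Continuous (diagDiff γ) := by
  unfold diagDiff
  fun_prop

lemma eq_of_apply_eq_of_lt_add_one (hper : Function.Periodic γ 1)
    (hemb : ∀ x ∈ Set.Ico (0:ℝ) 1, ∀ y ∈ Set.Ico (0:ℝ) 1, γ x = γ y → x = y) {x y : ℝ}
    (hxy : x ≤ y) (hlt : y < x + 1) (h : γ x = γ y) : x = y := by
  have hfr : ∀ z, γ (Int.fract z) = γ z := fun z => by
    rw [Int.fract, ← mul_one (⌊z⌋ : ℝ), hper.sub_int_mul_eq]
  have := hemb _ ⟨Int.fract_nonneg x, Int.fract_lt_one x⟩ _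
    ⟨Int.fract_nonneg y, Int.fract_lt_one y⟩ (by rw [hfr, hfr, h])
  obtain ⟨z, hz⟩ := Int.fract_eq_fract.1 this.symm
  have z0 : (0 : ℝ) ≤ z := by linarith
  have z1 : (z : ℝ) < 1 := by linarith
  have : z = 0 := by
    have := Int.cast_nonneg_iff.1 z0
    have : z < 1 := by exact_mod_cast z1
    omega
  rw [this, Int.cast_zero] at hz
  linarith

lemma exists_penalizedSide_pos (hper : Function.Periodic γ 1)
    (hemb : ∀ x ∈ Set.Ico (0:ℝ) 1, ∀ y ∈ Set.Ico (0:ℝ) 1, γ x = γ y → x = y) {ε : ℝ} (hε : 0 < ε)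
    {p : Fin 4 → ℝ} (hp : p ∈ orderedQuads) : ∃ i, 0 < penalizedSide γ ε p i := by
  by_contra! h
  obtain ⟨-, h01, h12, h23, -⟩ := hp
  have hgap : ∀ x : ℝ, x ≤ max 0 (x - (1 - ε)) + (1 - ε) := fun x => by
    linarith [le_max_right 0 (x - (1 - ε))]
  have key : ∀ {x y : ℝ}, x ≤ y → ‖γ x - γ y‖ + max 0 (y - x - (1 - ε)) ≤ 0 → x = y := by
    intro x y hxy h
    have := norm_nonneg (γ x - γ y)
    have := le_max_left 0 (y - x - (1 - ε))
    refine eq_of_apply_eq_of_lt_add_one hper hemb hxy (by linarith [hgap (y - x)]) ?_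
    exact sub_eq_zero.1 (norm_eq_zero.1 (by linarith))
  have e0 := key h01 (h 0)
  have e1 := key h12 (h 1)
  have e2 := key h23 (h 2)
  have h3 : ‖γ (p 3) - γ (p 0)‖ + max 0 (p 0 + 1 - p 3 - (1 - ε)) ≤ 0 := h 3
  linarith [hgap (p 0 + 1 - p 3), norm_nonneg (γ (p 3) - γ (p 0))]

lemma exists_short_arcs_arcTC_lt_pi
    (hnocusp : ∀ t : ℝ, ∃ a b : ℝ, a < t ∧ t < b ∧ b < a + 1 ∧ arcTC γ a b < Real.pi) :
    ∃ ε : ℝ, 0 < ε ∧ ε < 1 / 2 ∧ ∀ x ∈ Set.Icc (0 : ℝ) 1, ∃ a b : ℝ, b < a + 1 ∧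
      arcTC γ a b < Real.pi ∧ ∀ y, x ≤ y → y < x + ε → y ∈ Set.Ioo a b := by
  obtain ⟨δ, hδ, h⟩ := lebesgue_number_lemma_of_metric (isCompact_Icc (a := (0 : ℝ)) (b := 1))
    (c := fun i : {c : ℝ × ℝ // c.2 < c.1 + 1 ∧ arcTC γ c.1 c.2 < Real.pi} =>
      Set.Ioo i.1.1 i.1.2) (fun _ => isOpen_Ioo) fun t _ => by
        obtain ⟨a, b, hat, htb, hab, htc⟩ := hnocusp t
        exact Set.mem_iUnion.2 ⟨⟨(a, b), hab, htc⟩, hat, htb⟩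
  refine ⟨min δ (1 / 4), by positivity, (min_le_right _ _).trans_lt (by norm_num),
    fun x hx => ?_⟩
  obtain ⟨⟨⟨a, b⟩, hab, htc⟩, hsub⟩ := h x hx
  refine ⟨a, b, hab, htc, fun y hxy hy => hsub ?_⟩
  rw [Metric.mem_ball, Real.dist_eq, abs_of_nonneg (by linarith)]
  linarith [min_le_left δ (1 / 4)]

/-- A quadrilateral inscribed in a short arc does not have equal penalized sides. -/
lemma not_forall_penalizedSide_eq (hftc : FiniteTotalCurvature γ) {ε : ℝ} (hε2 : ε < 1 / 2)
    (hε : ∀ x ∈ Set.Icc (0 : ℝ) 1, ∃ a b : ℝ, b < a + 1 ∧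
      arcTC γ a b < Real.pi ∧ ∀ y, x ≤ y → y < x + ε → y ∈ Set.Ioo a b)
    {q : Fin 4 → ℝ} (h0 : q 0 ∈ Set.Icc (0 : ℝ) 1) (h01 : q 0 ≤ q 1) (h12 : q 1 ≤ q 2)
    (h23 : q 2 ≤ q 3) (h30 : q 3 < q 0 + ε) {r : ℝ} (hr : 0 < r) :
    ¬ ∀ i, penalizedSide γ ε q i = r := by
  intro h
  obtain ⟨a, b, hab, htc, hmem⟩ := hε _ h0
  have g0 : gap q 0 ≤ 1 - ε := by change q 1 - q 0 ≤ _; linarith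
  have g1 : gap q 1 ≤ 1 - ε := by change q 2 - q 1 ≤ _; linarith
  have g2 : gap q 2 ≤ 1 - ε := by change q 3 - q 2 ≤ _; linarith
  have hlt := lt_norm_sub_of_arcTC_lt_pi hftc hab htc hr h01 h12 h23
    (fun i => by fin_cases i <;> exact hmem _ (by simp; try linarith) (by simp; linarith))
    ((penalizedSide_of_gap_le g0).symm.trans (h 0)) ((penalizedSide_of_gap_le g1).symm.trans (h 1))
    ((penalizedSide_of_gap_le g2).symm.trans (h 2))
  have h3 : ‖γ (q 3) - γ (q 0)‖ + max 0 (q 0 + 1 - q 3 - (1 - ε)) = r := h 3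
  linarith [le_max_left 0 (q 0 + 1 - q 3 - (1 - ε))]

end InscribedQuadrilaterals

/-- **Main theorem.** Any embedded closed curve `γ : S¹ → ℝⁿ` of
finite total curvature without cusps has an inscribed square-like
quadrilateral: four distinct points in cyclic order on `γ` with equal positive
sides and equal diagonals. -/
theorem ftcwc_has_inscribed_slq {n : ℕ} (γ : ℝ → EuclideanSpace ℝ (Fin n))
    (hper : Function.Periodic γ 1) (hcont : Continuous γ)
    (hemb : ∀ x ∈ Set.Ico (0:ℝ) 1, ∀ y ∈ Set.Ico (0:ℝ) 1, γ x = γ y → x = y)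
    (hftc : FiniteTotalCurvature γ)
    (hnocusp : ∀ t : ℝ, ∃ a b : ℝ, a < t ∧ t < b ∧ b < a + 1 ∧
      arcTC γ a b < Real.pi) :
    ∃ t₁ t₂ t₃ t₄ : ℝ, t₁ < t₂ ∧ t₂ < t₃ ∧ t₃ < t₄ ∧ t₄ < t₁ + 1 ∧
      0 < ‖γ t₁ - γ t₂‖ ∧
      ‖γ t₁ - γ t₂‖ = ‖γ t₂ - γ t₃‖ ∧
      ‖γ t₂ - γ t₃‖ = ‖γ t₃ - γ t₄‖ ∧
      ‖γ t₃ - γ t₄‖ = ‖γ t₄ - γ t₁‖ ∧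
      ‖γ t₁ - γ t₃‖ = ‖γ t₂ - γ t₄‖ := by
  obtain ⟨ε, hε0, hε2, hε⟩ := exists_short_arcs_arcTC_lt_pi hnocusp
  have hzero : ∀ p i, gap p i = 0 → side γ p i = 0 → penalizedSide γ ε p i = 0 :=
    fun p i hg hs => (penalizedSide_of_gap_le (by linarith)).trans hs
  obtain ⟨p, hp, heq, hd⟩ := exists_forall_eq_and_eq_zero (penalizedSide γ ε) (diagDiff γ)
    (continuous_penalizedSide hcont ε) (continuous_diagDiff hcont)
    (penalizedSide_rotQuad hper ε) (diagDiff_rotQuad hper)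
    (fun p hp => exists_penalizedSide_pos hper hemb hε0 hp)
    (fun p _ h => hzero p 0 (by simp [gap, h]) (by simp [side, h]))
    (fun p _ h => hzero p 1 (by simp [gap, h]) (by simp [side, h]))
    (fun p _ h => hzero p 2 (by simp [gap, h]) (by simp [side, h]))
    (fun p _ h h' => hzero p 3 (by simp [gap, h, h'])
      (by simpa [side, h, h', sub_eq_zero] using hper 0))
  obtain ⟨i, hi⟩ := exists_penalizedSide_pos hper hemb hε0 hp
  set r := penalizedSide γ ε p i with hr
  have hall : ∀ j, penalizedSide γ ε p j = r := fun j => heq j i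
  have hall1 : ∀ j, penalizedSide γ ε (rotQuad p) j = r := fun j => by
    rw [penalizedSide_rotQuad hper, hall]
  have hall2 : ∀ j, penalizedSide γ ε (rotQuad (rotQuad p)) j = r := fun j => by
    rw [penalizedSide_rotQuad hper, hall1]
  have hall3 : ∀ j, penalizedSide γ ε (rotQuad (rotQuad (rotQuad p))) j = r := fun j => by
    rw [penalizedSide_rotQuad hper, hall2]
  have hI := mem_Icc_of_mem_orderedQuads hp
  obtain ⟨hp0, h01, h12, h23, hp3⟩ := hp
  have g0 : gap p 0 ≤ 1 - ε := by
    by_contra! hg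
    change 1 - ε < p 1 - p 0 at hg
    exact not_forall_penalizedSide_eq hftc hε2 hε (hI 1) h12 h23
      (show p 3 ≤ p 0 + 1 by linarith) (show p 0 + 1 < p 1 + ε by linarith) hi hall1
  have g1 : gap p 1 ≤ 1 - ε := by
    by_contra! hg
    change 1 - ε < p 2 - p 1 at hg
    exact not_forall_penalizedSide_eq hftc hε2 hε (hI 2) h23
      (show p 3 ≤ p 0 + 1 by linarith) (show p 0 + 1 ≤ p 1 + 1 by linarith)
      (show p 1 + 1 < p 2 + ε by linarith) hi hall2
  have g2 : gap p 2 ≤ 1 - ε := by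
    by_contra! hg
    change 1 - ε < p 3 - p 2 at hg
    exact not_forall_penalizedSide_eq hftc hε2 hε (hI 3)
      (show p 3 ≤ p 0 + 1 by linarith) (show p 0 + 1 ≤ p 1 + 1 by linarith)
      (show p 1 + 1 ≤ p 2 + 1 by linarith) (show p 2 + 1 < p 3 + ε by linarith) hi hall3
  have g3 : gap p 3 ≤ 1 - ε := by
    by_contra! hg
    change 1 - ε < p 0 + 1 - p 3 at hg
    exact not_forall_penalizedSide_eq hftc hε2 hε (hI 0) h01 h12 h23 (by linarith) hi hall
  have s0 : ‖γ (p 0) - γ (p 1)‖ = r := (penalizedSide_of_gap_le g0).symm.trans (hall 0)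
  have s1 : ‖γ (p 1) - γ (p 2)‖ = r := (penalizedSide_of_gap_le g1).symm.trans (hall 1)
  have s2 : ‖γ (p 2) - γ (p 3)‖ = r := (penalizedSide_of_gap_le g2).symm.trans (hall 2)
  have s3 : ‖γ (p 3) - γ (p 0)‖ = r := (penalizedSide_of_gap_le g3).symm.trans (hall 3)
  have hlt : ∀ {x y : ℝ}, x ≤ y → ‖γ x - γ y‖ = r → x < y := fun {x y} hxy h =>
    hxy.lt_of_ne fun e => hi.ne (by simpa [e] using h)
  refine ⟨p 0, p 1, p 2, p 3, hlt h01 s0, hlt h12 s1, hlt h23 s2,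
    hlt (by linarith) (by rw [hper]; exact s3), by rw [s0]; exact hi, by rw [s0, s1],
    by rw [s1, s2], by rw [s2, s3], sub_eq_zero.1 hd⟩
end
end

section
/- Every C²-smooth embedded closed curve γ : S¹ → ℝ² has an inscribed square: four distinct points p,q,r,s on γ forming the vertices of a square. -/
/-- The cyclic successor map on lifts of quadruples of points on a circle of length `N`. -/
def cyclicShift (N : ℤ) (v : Fin 4 → ℤ) : Fin 4 → ℤ :=
  fun a => v (a + 1) + if a = 3 then N else 0

/-- The quadruple `v` lifts a cyclically ordered quadruple on a circle of length `N`. -/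
def IsCyclicallyOrdered (N : ℤ) (v : Fin 4 → ℤ) : Prop := ∀ a, v a ≤ cyclicShift N v a

/-- The `j`-th vertex of the Freudenthal simplex based at `τ.1` in which the coordinate `a`
is incremented at time `τ.2 a`. -/
def vertex (τ : (Fin 4 → ℤ) × Equiv.Perm (Fin 4)) (j : Fin 5) : Fin 4 → ℤ :=
  fun a => τ.1 a + if (τ.2 a : ℕ) < j then 1 else 0

lemma sum_vertex (τ : (Fin 4 → ℤ) × Equiv.Perm (Fin 4)) (j : Fin 5) :
    ∑ a, vertex τ j a = ∑ a, τ.1 a + j := by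
  simp only [vertex, Finset.sum_add_distrib, add_right_inj]
  rw [Equiv.sum_comp τ.2 (fun b : Fin 4 => if (b : ℕ) < j then (1 : ℤ) else 0)]
  revert j
  decide

lemma sum_cyclicShift (N : ℤ) (v : Fin 4 → ℤ) :
    ∑ a, cyclicShift N v a = ∑ a, v a + N := by
  simp [cyclicShift, Fin.sum_univ_four]
  ring

open Classical in
/-- The Freudenthal simplices of level `h` all of whose vertices are cyclically ordered. -/
noncomputable def cyclicSimplices (N h : ℤ) : Finset ((Fin 4 → ℤ) × Equiv.Perm (Fin 4)) :=
  ((Finset.Icc (fun _ => -(|h| + 3 * |N|)) (fun _ => |h| + 3 * |N|)) ×ˢ Finset.univ).filter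
    fun τ => ∑ a, τ.1 a = h ∧ ∀ j, IsCyclicallyOrdered N (vertex τ j)

lemma isCyclicallyOrdered_iff {N : ℤ} {v : Fin 4 → ℤ} :
    IsCyclicallyOrdered N v ↔ v 0 ≤ v 1 ∧ v 1 ≤ v 2 ∧ v 2 ≤ v 3 ∧ v 3 ≤ v 0 + N := by
  simp [IsCyclicallyOrdered, cyclicShift, Fin.forall_fin_succ]

@[simp] lemma vertex_zero (τ : (Fin 4 → ℤ) × Equiv.Perm (Fin 4)) : vertex τ 0 = τ.1 := by
  ext a; simp [vertex]

lemma mem_cyclicSimplices {N h : ℤ} {τ : (Fin 4 → ℤ) × Equiv.Perm (Fin 4)} :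
    τ ∈ cyclicSimplices N h ↔ ∑ a, τ.1 a = h ∧ ∀ j, IsCyclicallyOrdered N (vertex τ j) := by
  classical
  simp only [cyclicSimplices, Finset.mem_filter, Finset.mem_product, Finset.mem_univ, and_true,
    Finset.mem_Icc, and_iff_right_iff_imp, Pi.le_def, Fin.forall_fin_succ (n := 3)]
  rintro ⟨hs, hc⟩
  have h0 := hc 0
  rw [vertex_zero, isCyclicallyOrdered_iff] at h0
  rw [Fin.sum_univ_four] at hs
  simp [Fin.forall_fin_succ]
  grind

/-- The facet of `τ` opposite to the vertex `k` carries all four labels and satisfies `P`. -/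
def IsRainbow (l : (Fin 4 → ℤ) → Fin 4) (P : (Fin 4 → ℤ) → Prop)
    (τ : (Fin 4 → ℤ) × Equiv.Perm (Fin 4)) (k : Fin 5) : Prop :=
  (∀ a, ∃ j, j ≠ k ∧ l (vertex τ j) = a) ∧ ∀ j, j ≠ k → P (vertex τ j)

/-- Among the facets of a labelled simplex, an even number carry all labels. -/
lemma sum_rainbow_facets (L : Fin 5 → Fin 4) :
    ∑ k, (if ∀ a, ∃ j, j ≠ k ∧ L j = a then (1 : ZMod 2) else 0) = 0 := by
  classical
  by_cases hL : ∃ k, ∀ a, ∃ j, j ≠ k ∧ L j = a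
  · obtain ⟨k, hk⟩ := hL
    obtain ⟨m, hmk, hm⟩ := hk (L k)
    choose f hf hfL using hk
    have hinj : Function.Injective f := fun a b h => by rw [← hfL a, h, hfL]
    have himg : Finset.univ.image f = Finset.univ.erase k := by
      apply Finset.eq_of_subset_of_card_le
      · intro x hx; simp at hx ⊢; grind
      · rw [Finset.card_image_of_injective _ hinj]; simp
    have hfs : ∀ x, x ≠ k → f (L x) = x := by
      intro x hx
      have : x ∈ Finset.univ.image f := by rw [himg]; simp [hx]
      obtain ⟨a, -, rfl⟩ := Finset.mem_image.1 this
      rw [hfL]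
    have key : ∀ x, (∀ a, ∃ j, j ≠ x ∧ L j = a) ↔ x ∈ ({k, m} : Finset (Fin 5)) := by
      intro x
      simp only [Finset.mem_insert, Finset.mem_singleton]
      constructor
      · intro h
        by_contra! hx
        obtain ⟨j, hj, hjx⟩ := h (L x)
        by_cases hjk : j = k
        · apply hx.2
          rw [← hfs x hx.1, ← hfs m hmk, hm, ← hjx, hjk]
        · exact hj (by rw [← hfs j hjk, hjx, hfs x hx.1])
      · rintro (rfl | rfl) a
        · exact ⟨f a, hf a, hfL a⟩
        · by_cases h : f a = x
          · exact ⟨k, hmk.symm, by rw [← hm, ← h, hfL]⟩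
          · exact ⟨f a, h, hfL a⟩
    simp_rw [key]
    rw [Finset.sum_ite_mem, Finset.univ_inter, Finset.sum_pair hmk.symm]
    decide
  · push Not at hL
    exact Finset.sum_eq_zero fun k _ => if_neg (by push Not; exact hL k)

lemma swap_val_lt_iff {i j x : Fin 4} {k m : Fin 5} (hi : (i : ℕ) + 1 = k) (hj : (j : ℕ) = k)
    (hm : m ≠ k) : (Equiv.swap i j x : ℕ) < m ↔ (x : ℕ) < m := by
  rw [Equiv.swap_apply_def]
  split_ifs <;> grind

/-- Exchanging two consecutive increments of a simplex. -/
def exchange (i j : Fin 4) (τ : (Fin 4 → ℤ) × Equiv.Perm (Fin 4)) :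
    (Fin 4 → ℤ) × Equiv.Perm (Fin 4) :=
  (τ.1, τ.2.trans (Equiv.swap i j))

lemma vertex_exchange {i j : Fin 4} {k m : Fin 5} (hi : (i : ℕ) + 1 = k) (hj : (j : ℕ) = k)
    (hm : m ≠ k) (τ : (Fin 4 → ℤ) × Equiv.Perm (Fin 4)) :
    vertex (exchange i j τ) m = vertex τ m := by
  ext a
  simp [vertex, exchange, swap_val_lt_iff hi hj hm]

lemma exchange_exchange (i j : Fin 4) (τ : (Fin 4 → ℤ) × Equiv.Perm (Fin 4)) :
    exchange i j (exchange i j τ) = τ := by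
  ext <;> simp [exchange]

lemma exchange_ne {i j : Fin 4} (hij : i ≠ j) (τ : (Fin 4 → ℤ) × Equiv.Perm (Fin 4)) :
    exchange i j τ ≠ τ := by
  intro h
  have h2 : (τ.2.trans (Equiv.swap i j)) = τ.2 := congrArg Prod.snd h
  have h3 := congrArg (fun e => e (τ.2.symm i)) h2
  simp at h3
  exact hij h3.symm

lemma isRainbow_exchange {l : (Fin 4 → ℤ) → Fin 4} {P : (Fin 4 → ℤ) → Prop} {i j : Fin 4}
    {k : Fin 5} (hi : (i : ℕ) + 1 = k) (hj : (j : ℕ) = k)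
    {τ : (Fin 4 → ℤ) × Equiv.Perm (Fin 4)} (h : IsRainbow l P τ k) :
    IsRainbow l P (exchange i j τ) k := by
  refine ⟨fun a => ?_, fun m hm => ?_⟩
  · obtain ⟨m, hm, h⟩ := h.1 a
    exact ⟨m, hm, by rwa [vertex_exchange hi hj hm]⟩
  · rw [vertex_exchange hi hj hm]
    exact h.2 m hm

lemma exchange_aux {x y z : ℤ} {p q i j : Fin 4} {m n : Fin 5} (hi : (i : ℕ) + 1 = m)
    (hj : (j : ℕ) = m) (hn : n ≠ m) (hpq : p ≠ q)
    (h1 : (x + if (p : ℕ) < n then 1 else 0) < (y + if (q : ℕ) < n then 1 else 0) + z)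
    (h2 : (x + if (p : ℕ) < m then 1 else 0) ≤ (y + if (q : ℕ) < m then 1 else 0) + z)
    (h3 : (x + if (p : ℕ) < i.castSucc then 1 else 0) ≤
      (y + if (q : ℕ) < i.castSucc then 1 else 0) + z)
    (h4 : (x + if (p : ℕ) < j.succ then 1 else 0) ≤
      (y + if (q : ℕ) < j.succ then 1 else 0) + z) :
    (x + if (Equiv.swap i j p : ℕ) < m then 1 else 0) ≤
      (y + if (Equiv.swap i j q : ℕ) < m then 1 else 0) + z := by
  have hpq' : (p : ℕ) ≠ q := fun h => hpq (Fin.ext h)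
  rw [Fin.val_castSucc] at h3
  rw [Fin.val_succ] at h4
  have hp : (Equiv.swap i j p : ℕ) =
      if (p : ℕ) = i then (j : ℕ) else if (p : ℕ) = j then i else p := by
    simp only [Equiv.swap_apply_def, Fin.ext_iff]
    split_ifs <;> rfl
  have hq : (Equiv.swap i j q : ℕ) =
      if (q : ℕ) = i then (j : ℕ) else if (q : ℕ) = j then i else q := by
    simp only [Equiv.swap_apply_def, Fin.ext_iff]
    split_ifs <;> rfl
  rw [hp, hq]
  clear hp hq
  by_cases hpi : (p : ℕ) = i <;> by_cases hqi : (q : ℕ) = i <;>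
    by_cases hpj : (p : ℕ) = j <;> by_cases hqj : (q : ℕ) = j <;>
    simp only [hpi, hqi, hpj, hqj, if_true, if_false] at * <;> grind

lemma exchange_mem {N h : ℤ} {l : (Fin 4 → ℤ) → Fin 4} {P : (Fin 4 → ℤ) → Prop}
    (hl : ∀ v, IsCyclicallyOrdered N v → v (l v) < cyclicShift N v (l v)) {i j : Fin 4}
    {k : Fin 5} (hi : (i : ℕ) + 1 = k) (hj : (j : ℕ) = k)
    {τ : (Fin 4 → ℤ) × Equiv.Perm (Fin 4)} (hτ : τ ∈ cyclicSimplices N h)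
    (hr : IsRainbow l P τ k) : exchange i j τ ∈ cyclicSimplices N h := by
  rw [mem_cyclicSimplices] at hτ ⊢
  refine ⟨hτ.1, fun m => ?_⟩
  by_cases hm : m = k
  swap
  · rw [vertex_exchange hi hj hm]
    exact hτ.2 m
  subst hm
  intro a
  obtain ⟨n, hn, hna⟩ := hr.1 a
  have h1 := hl _ (hτ.2 n)
  rw [hna] at h1
  clear hl hna hr
  have h2 := hτ.2 m a
  have h3 := hτ.2 i.castSucc a
  have h4 := hτ.2 j.succ a
  have hne : τ.2 a ≠ τ.2 (a + 1) := by
    intro h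
    have := τ.2.injective h
    exact absurd this ((by decide : ∀ b : Fin 4, b ≠ b + 1) a)
  exact exchange_aux hi hj hn hne h1 h2 h3 h4

open Classical in
/-- The parity of the number of rainbow facets in the sheet of level `h`. -/
noncomputable def rainbowParity (N h : ℤ) (l : (Fin 4 → ℤ) → Fin 4)
    (P : (Fin 4 → ℤ) → Prop) : ZMod 2 :=
  ∑ τ ∈ cyclicSimplices N h, if IsRainbow l P τ 4 then 1 else 0

open Classical in
lemma sum_interior_facets {N h : ℤ} {l : (Fin 4 → ℤ) → Fin 4} {P : (Fin 4 → ℤ) → Prop}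
    (hl : ∀ v, IsCyclicallyOrdered N v → v (l v) < cyclicShift N v (l v)) {i j : Fin 4}
    {k : Fin 5} (hi : (i : ℕ) + 1 = k) (hj : (j : ℕ) = k) :
    ∑ τ ∈ cyclicSimplices N h, (if IsRainbow l P τ k then (1 : ZMod 2) else 0) = 0 := by
  rw [← Finset.sum_filter]
  refine Finset.sum_involution (fun τ _ => exchange i j τ) (fun _ _ => by decide)
    (fun τ _ _ => exchange_ne (fun h => by rw [h] at hi; omega) τ) (fun τ hτ => ?_)
    (fun τ _ => exchange_exchange i j τ)
  rw [Finset.mem_filter] at hτ ⊢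
  exact ⟨exchange_mem hl hi hj hτ.1 hτ.2, isRainbow_exchange hi hj hτ.2⟩

/-- Moving the base point of a simplex to its next vertex. -/
def advance (τ : (Fin 4 → ℤ) × Equiv.Perm (Fin 4)) : (Fin 4 → ℤ) × Equiv.Perm (Fin 4) :=
  (vertex τ 1, τ.2.trans (Equiv.subRight 1))

/-- The inverse of `advance`. -/
def retreat (τ : (Fin 4 → ℤ) × Equiv.Perm (Fin 4)) : (Fin 4 → ℤ) × Equiv.Perm (Fin 4) :=
  (fun a => vertex τ 3 a - 1, τ.2.trans (Equiv.addRight 1))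

lemma vertex_advance (τ : (Fin 4 → ℤ) × Equiv.Perm (Fin 4)) (j : Fin 4) :
    vertex (advance τ) j.castSucc = vertex τ j.succ := by
  ext a
  simp only [vertex, advance, Equiv.trans_apply, Equiv.subRight_apply, add_assoc, add_right_inj]
  generalize τ.2 a = p
  revert p j
  decide

lemma vertex_last (τ : (Fin 4 → ℤ) × Equiv.Perm (Fin 4)) : vertex τ 4 = fun a => τ.1 a + 1 := by
  ext a
  simp [vertex]

lemma retreat_advance (τ : (Fin 4 → ℤ) × Equiv.Perm (Fin 4)) : retreat (advance τ) = τ := by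
  have h := vertex_advance τ 3
  ext a
  · simp only [retreat]
    change vertex (advance τ) (Fin.castSucc 3) a - 1 = _
    rw [h]
    change vertex τ 4 a - 1 = _
    simp [vertex_last]
  · simp [retreat, advance]

lemma advance_retreat (τ : (Fin 4 → ℤ) × Equiv.Perm (Fin 4)) : advance (retreat τ) = τ := by
  ext a
  · have : ∀ p : Fin 4, (if (p : ℕ) < (3 : Fin 5) then (1 : ℤ) else 0) - 1 +
      (if ((p + 1 : Fin 4) : ℕ) < (1 : Fin 5) then (1 : ℤ) else 0) = 0 := by decide
    change τ.1 a + (if (τ.2 a : ℕ) < (3 : Fin 5) then (1 : ℤ) else 0) - 1 +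
      (if ((τ.2 a + 1 : Fin 4) : ℕ) < (1 : Fin 5) then (1 : ℤ) else 0) = τ.1 a
    linarith [this (τ.2 a)]
  · simp [retreat, advance]

lemma isCyclicallyOrdered_add_one {N : ℤ} {v : Fin 4 → ℤ} :
    IsCyclicallyOrdered N (fun a => v a + 1) ↔ IsCyclicallyOrdered N v := by
  simp [isCyclicallyOrdered_iff]
  grind

lemma advance_mem_iff {N h : ℤ} {τ : (Fin 4 → ℤ) × Equiv.Perm (Fin 4)} :
    advance τ ∈ cyclicSimplices N (h + 1) ↔ τ ∈ cyclicSimplices N h := by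
  rw [mem_cyclicSimplices, mem_cyclicSimplices]
  have h1 : ∑ a, (advance τ).1 a = ∑ a, τ.1 a + 1 := sum_vertex τ 1
  rw [h1, add_left_inj, Fin.forall_fin_succ',
    Fin.forall_fin_succ (P := fun j => IsCyclicallyOrdered N (vertex τ j))]
  simp only [vertex_advance]
  have h2 : IsCyclicallyOrdered N (vertex (advance τ) (Fin.last 4)) ↔
      IsCyclicallyOrdered N (vertex τ 1) := by
    change IsCyclicallyOrdered N (vertex (advance τ) 4) ↔ _
    rw [vertex_last, isCyclicallyOrdered_add_one]
    rfl
  have h3 : IsCyclicallyOrdered N (vertex τ 4) ↔ IsCyclicallyOrdered N (vertex τ 0) := by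
    rw [vertex_last, isCyclicallyOrdered_add_one, vertex_zero]
  rw [h2]
  refine and_congr_right fun _ => ⟨fun h => ⟨h3.1 (h.1 3), h.1⟩, fun h => ⟨h.2, h.2 0⟩⟩

lemma isRainbow_advance {l : (Fin 4 → ℤ) → Fin 4} {P : (Fin 4 → ℤ) → Prop}
    {τ : (Fin 4 → ℤ) × Equiv.Perm (Fin 4)} :
    IsRainbow l P (advance τ) 4 ↔ IsRainbow l P τ 0 := by
  have e4 : (4 : Fin 5) = Fin.last 4 := rfl
  unfold IsRainbow
  refine and_congr (forall_congr' fun a => ?_) ?_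
  · rw [Fin.exists_fin_succ', Fin.exists_fin_succ (P := fun j => j ≠ 0 ∧ _)]
    simp only [vertex_advance, e4, Fin.castSucc_ne_last, Fin.succ_ne_zero, ne_eq, not_true,
      not_false_eq_true, true_and, false_and, or_false, false_or]
  · rw [Fin.forall_fin_succ', Fin.forall_fin_succ (P := fun j => j ≠ 0 → _)]
    simp only [vertex_advance, e4, Fin.castSucc_ne_last, Fin.succ_ne_zero, ne_eq, not_true,
      not_false_eq_true, forall_const, false_imp_iff, true_and, and_true]

open Classical in
lemma rainbowParity_succ_eq {N h : ℤ} {l : (Fin 4 → ℤ) → Fin 4} {P : (Fin 4 → ℤ) → Prop} :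
    rainbowParity N (h + 1) l P =
      ∑ τ ∈ cyclicSimplices N h, if IsRainbow l P τ 0 then 1 else 0 := by
  refine (Finset.sum_bij' (fun τ _ => advance τ) (fun τ _ => retreat τ)
    (fun τ hτ => advance_mem_iff.2 hτ) (fun τ hτ => ?_) (fun τ _ => retreat_advance τ)
    (fun τ _ => advance_retreat τ) (fun τ _ => ?_)).symm
  · rwa [← advance_mem_iff, advance_retreat]
  · simp [isRainbow_advance]

open Classical in
lemma sum_isRainbow {l : (Fin 4 → ℤ) → Fin 4} {P : (Fin 4 → ℤ) → Prop}
    {τ : (Fin 4 → ℤ) × Equiv.Perm (Fin 4)}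
    (h : (∀ a, ∃ j, l (vertex τ j) = a) →
      (∀ j, P (vertex τ j)) ∨ ∀ j, ¬ P (vertex τ j)) :
    ∑ k, (if IsRainbow l P τ k then (1 : ZMod 2) else 0) = 0 := by
  by_cases hs : ∀ a, ∃ j, l (vertex τ j) = a
  · rcases h hs with h | h
    · refine Eq.trans ?_ (sum_rainbow_facets fun j => l (vertex τ j))
      refine Finset.sum_congr rfl fun k _ => ?_
      congr 1
      simp [IsRainbow, h]
    · refine Finset.sum_eq_zero fun k _ => if_neg fun hk => ?_
      obtain ⟨m, hm⟩ := exists_ne k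
      exact h m (hk.2 m hm)
  · refine Finset.sum_eq_zero fun k _ => if_neg fun hk => hs fun a => ?_
    obtain ⟨j, -, hj⟩ := hk.1 a
    exact ⟨j, hj⟩

lemma rainbowParity_succ {N h : ℤ} {l : (Fin 4 → ℤ) → Fin 4} {P : (Fin 4 → ℤ) → Prop}
    (hl : ∀ v, IsCyclicallyOrdered N v → v (l v) < cyclicShift N v (l v))
    (hP : ∀ τ ∈ cyclicSimplices N h, (∀ a, ∃ j, l (vertex τ j) = a) →
      (∀ j, P (vertex τ j)) ∨ ∀ j, ¬ P (vertex τ j)) :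
    rainbowParity N (h + 1) l P = rainbowParity N h l P := by
  classical
  have h0 : ∑ k, ∑ τ ∈ cyclicSimplices N h,
      (if IsRainbow l P τ k then (1 : ZMod 2) else 0) = 0 := by
    rw [Finset.sum_comm]
    exact Finset.sum_eq_zero fun τ hτ => sum_isRainbow (hP τ hτ)
  rw [Fin.sum_univ_five, sum_interior_facets (k := 1) (i := 0) (j := 1) hl rfl rfl,
    sum_interior_facets (k := 2) (i := 1) (j := 2) hl rfl rfl,
    sum_interior_facets (k := 3) (i := 2) (j := 3) hl rfl rfl, add_zero, add_zero, add_zero,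
    ← rainbowParity_succ_eq] at h0
  rw [rainbowParity.eq_def N h, ← sub_eq_zero, CharTwo.sub_eq_add]
  exact h0

lemma rainbowParity_add {N h : ℤ} {l : (Fin 4 → ℤ) → Fin 4} {P : (Fin 4 → ℤ) → Prop}
    (hl : ∀ v, IsCyclicallyOrdered N v → v (l v) < cyclicShift N v (l v)) (n : ℕ)
    (hP : ∀ m, h ≤ m → m < h + n → ∀ τ ∈ cyclicSimplices N m,
      (∀ a, ∃ j, l (vertex τ j) = a) → (∀ j, P (vertex τ j)) ∨ ∀ j, ¬ P (vertex τ j)) :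
    rainbowParity N (h + n) l P = rainbowParity N h l P := by
  induction n with
  | zero => simp
  | succ n ih =>
    push_cast
    rw [← add_assoc, rainbowParity_succ hl (hP _ (by omega) (by push_cast; omega))]
    exact ih fun m h1 h2 => hP m h1 (by push_cast; omega)

lemma isRainbow_congr {N h : ℤ} {l l' : (Fin 4 → ℤ) → Fin 4} {P P' : (Fin 4 → ℤ) → Prop}
    (hl : ∀ v, h ≤ ∑ a, v a → ∑ a, v a ≤ h + 3 → l v = l' v)
    (hP : ∀ v, h ≤ ∑ a, v a → ∑ a, v a ≤ h + 3 → (P v ↔ P' v))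
    {τ : (Fin 4 → ℤ) × Equiv.Perm (Fin 4)} (hτ : τ ∈ cyclicSimplices N h) :
    IsRainbow l P τ 4 ↔ IsRainbow l' P' τ 4 := by
  have hs := (mem_cyclicSimplices.1 hτ).1
  have hb : ∀ j : Fin 5, j ≠ 4 → h ≤ ∑ a, vertex τ j a ∧ ∑ a, vertex τ j a ≤ h + 3 := by
    intro j hj
    rw [sum_vertex, hs]
    omega
  refine and_congr (forall_congr' fun a => exists_congr fun j => and_congr_right fun hj => ?_)
    (forall_congr' fun j => imp_congr_right fun hj => hP _ (hb j hj).1 (hb j hj).2)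
  rw [hl _ (hb j hj).1 (hb j hj).2]

lemma rainbowParity_congr {N h : ℤ} {l l' : (Fin 4 → ℤ) → Fin 4} {P P' : (Fin 4 → ℤ) → Prop}
    (hl : ∀ v, h ≤ ∑ a, v a → ∑ a, v a ≤ h + 3 → l v = l' v)
    (hP : ∀ v, h ≤ ∑ a, v a → ∑ a, v a ≤ h + 3 → (P v ↔ P' v)) :
    rainbowParity N h l P = rainbowParity N h l' P' := by
  refine Finset.sum_congr rfl fun τ hτ => ?_
  rw [isRainbow_congr hl hP hτ]

/-- The first nonzero gap of a quadruple. -/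
def firstGap (v : Fin 4 → ℤ) : Fin 4 :=
  if v 0 < v 1 then 0 else if v 1 < v 2 then 1 else if v 2 < v 3 then 2 else 3

lemma firstGap_pos {N : ℤ} (hN : 0 < N) {v : Fin 4 → ℤ} (hv : IsCyclicallyOrdered N v) :
    v (firstGap v) < cyclicShift N v (firstGap v) := by
  rw [isCyclicallyOrdered_iff] at hv
  unfold firstGap
  split_ifs <;> simp [cyclicShift] <;> omega

lemma rainbowParity_firstGap {N : ℤ} (hN : 0 < N) :
    rainbowParity N (-4) firstGap (fun _ => True) = 1 := by
  classical
  rw [rainbowParity, Finset.sum_eq_single ((fun _ => -1, Fin.revPerm) :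
    (Fin 4 → ℤ) × Equiv.Perm (Fin 4))]
  · refine if_pos ⟨?_, fun _ _ => trivial⟩
    decide
  · intro τ hτ hne
    refine if_neg fun hr => hne ?_
    obtain ⟨hs, hc⟩ := mem_cyclicSimplices.1 hτ
    obtain ⟨j, hj, hj3⟩ := hr.1 3
    have hcj := isCyclicallyOrdered_iff.1 (hc j)
    have hsj := sum_vertex τ j
    rw [hs, Fin.sum_univ_four] at hsj
    have hv : vertex τ j 0 = vertex τ j 1 ∧ vertex τ j 1 = vertex τ j 2 ∧
        vertex τ j 2 = vertex τ j 3 := by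
      unfold firstGap at hj3
      split_ifs at hj3 <;> first | contradiction | omega
    have hj0 : j = 0 := by omega
    subst hj0
    rw [vertex_zero] at *
    have hτ1 : τ.1 = fun _ => -1 := by
      ext a
      simp at hsj
      fin_cases a <;> simp <;> omega
    have hanti : ∀ a b : Fin 4, (∀ j, vertex τ j a ≤ vertex τ j b) → τ.2 b ≤ τ.2 a := by
      intro a b h
      have := h (τ.2 a).succ
      simp [vertex, hτ1] at this
      by_contra! hlt
      rw [Fin.lt_def] at hlt
      split_ifs at this <;> omega
    have h01 := hanti 0 1 fun j => (isCyclicallyOrdered_iff.1 (hc j)).1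
    have h12 := hanti 1 2 fun j => (isCyclicallyOrdered_iff.1 (hc j)).2.1
    have h23 := hanti 2 3 fun j => (isCyclicallyOrdered_iff.1 (hc j)).2.2.1
    have n01 : τ.2 0 ≠ τ.2 1 := by simp
    have n12 : τ.2 1 ≠ τ.2 2 := by simp
    have n23 : τ.2 2 ≠ τ.2 3 := by simp
    refine Prod.ext hτ1 (Equiv.ext fun a => ?_)
    have h0 : τ.2 0 = 3 := by omega
    have h1 : τ.2 1 = 2 := by omega
    have h2 : τ.2 2 = 1 := by omega
    have h3 : τ.2 3 = 0 := by omega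
    fin_cases a
    exacts [h0, h1, h2, h3]
  · intro h
    refine absurd (mem_cyclicSimplices.2 ⟨by simp, fun j => ?_⟩) h
    rw [isCyclicallyOrdered_iff]
    simp [vertex]
    fin_cases j <;> simp <;> omega

lemma rainbowParity_zero {N : ℤ} (hN : 0 < N) {l : (Fin 4 → ℤ) → Fin 4}
    (hl : ∀ v, IsCyclicallyOrdered N v → v (l v) < cyclicShift N v (l v)) :
    rainbowParity N 0 l (fun _ => True) = 1 := by
  classical
  set l' : (Fin 4 → ℤ) → Fin 4 := fun v => if ∑ a, v a < 0 then firstGap v else l v with hl'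
  have h1 : rainbowParity N 0 l (fun _ => True) = rainbowParity N 0 l' (fun _ => True) :=
    rainbowParity_congr (fun v hv _ => by simp only [hl', if_neg hv.not_gt]) (by simp)
  have h2 : rainbowParity N (-4) l' (fun _ => True) = 1 := by
    rw [← rainbowParity_firstGap hN]
    exact rainbowParity_congr
      (fun v _ hv => by simp only [hl', if_pos (show ∑ a, v a < 0 by omega)]) (by simp)
  rw [h1, ← h2]
  have h3 : ∀ v, IsCyclicallyOrdered N v → v (l' v) < cyclicShift N v (l' v) := fun v hv => ?_
  · simpa using rainbowParity_add (h := -4) (P := fun _ => True) h3 4 (by simp)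
  simp only [hl']
  split_ifs
  · exact firstGap_pos hN hv
  · exact hl v hv

/-- The inverse of `cyclicShift`. -/
def cyclicUnshift (N : ℤ) (v : Fin 4 → ℤ) : Fin 4 → ℤ :=
  fun a => v (a - 1) - if a = 0 then N else 0

lemma cyclicUnshift_cyclicShift (N : ℤ) (v : Fin 4 → ℤ) :
    cyclicUnshift N (cyclicShift N v) = v := by
  ext a
  have : a - 1 = 3 ↔ a = 0 := by revert a; decide
  simp [cyclicShift, cyclicUnshift, this]

lemma cyclicShift_cyclicUnshift (N : ℤ) (v : Fin 4 → ℤ) :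
    cyclicShift N (cyclicUnshift N v) = v := by
  ext a
  have : a + 1 = 0 ↔ a = 3 := by revert a; decide
  simp [cyclicShift, cyclicUnshift, this]

lemma isCyclicallyOrdered_cyclicShift {N : ℤ} {v : Fin 4 → ℤ} :
    IsCyclicallyOrdered N (cyclicShift N v) ↔ IsCyclicallyOrdered N v := by
  simp [isCyclicallyOrdered_iff, cyclicShift]
  grind

/-- The action of `cyclicShift` on simplices. -/
def shiftSimplex (N : ℤ) (τ : (Fin 4 → ℤ) × Equiv.Perm (Fin 4)) :
    (Fin 4 → ℤ) × Equiv.Perm (Fin 4) :=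
  (cyclicShift N τ.1, (Equiv.addRight 1).trans τ.2)

/-- The inverse of `shiftSimplex`. -/
def unshiftSimplex (N : ℤ) (τ : (Fin 4 → ℤ) × Equiv.Perm (Fin 4)) :
    (Fin 4 → ℤ) × Equiv.Perm (Fin 4) :=
  (cyclicUnshift N τ.1, (Equiv.subRight 1).trans τ.2)

lemma vertex_shiftSimplex (N : ℤ) (τ : (Fin 4 → ℤ) × Equiv.Perm (Fin 4)) (j : Fin 5) :
    vertex (shiftSimplex N τ) j = cyclicShift N (vertex τ j) := by
  ext a
  exact add_right_comm _ _ _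

lemma shiftSimplex_mem_iff {N h : ℤ} {τ : (Fin 4 → ℤ) × Equiv.Perm (Fin 4)} :
    shiftSimplex N τ ∈ cyclicSimplices N (h + N) ↔ τ ∈ cyclicSimplices N h := by
  simp only [mem_cyclicSimplices, vertex_shiftSimplex, isCyclicallyOrdered_cyclicShift]
  refine and_congr_left fun _ => ?_
  change ∑ a, cyclicShift N τ.1 a = _ ↔ _
  rw [sum_cyclicShift, add_left_inj]

lemma rainbowParity_add_period {N h : ℤ} {l : (Fin 4 → ℤ) → Fin 4} {P : (Fin 4 → ℤ) → Prop} :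
    rainbowParity N (h + N) l P = rainbowParity N h (fun v => l (cyclicShift N v))
      (fun v => P (cyclicShift N v)) := by
  classical
  have h1 : ∀ τ, shiftSimplex N (unshiftSimplex N τ) = τ := fun τ =>
    Prod.ext (cyclicShift_cyclicUnshift N _) (by ext; simp [shiftSimplex, unshiftSimplex])
  have h2 : ∀ τ, unshiftSimplex N (shiftSimplex N τ) = τ := fun τ =>
    Prod.ext (cyclicUnshift_cyclicShift N _) (by ext; simp [shiftSimplex, unshiftSimplex])
  refine (Finset.sum_bij' (fun τ _ => shiftSimplex N τ) (fun τ _ => unshiftSimplex N τ)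
    (fun τ hτ => shiftSimplex_mem_iff.2 hτ) (fun τ hτ => ?_) (fun τ _ => h2 τ)
    (fun τ _ => h1 τ) (fun τ _ => ?_)).symm
  · rwa [← shiftSimplex_mem_iff, h1]
  · congr 1
    simp only [IsRainbow, vertex_shiftSimplex]

lemma rainbowParity_perm {N h : ℤ} (e : Equiv.Perm (Fin 4)) {l : (Fin 4 → ℤ) → Fin 4}
    {P : (Fin 4 → ℤ) → Prop} :
    rainbowParity N h (fun v => e (l v)) P = rainbowParity N h l P := by
  classical
  refine Finset.sum_congr rfl fun τ _ => ?_
  congr 1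
  simp only [IsRainbow, eq_iff_iff]
  refine and_congr_left fun _ => ?_
  rw [← e.forall_congr_right]
  simp

lemma rainbowParity_split {N h : ℤ} {l : (Fin 4 → ℤ) → Fin 4} {P : (Fin 4 → ℤ) → Prop}
    (hP : ∀ τ ∈ cyclicSimplices N h, (∀ a, ∃ j, l (vertex τ j) = a) →
      (∀ j, P (vertex τ j)) ∨ ∀ j, ¬ P (vertex τ j)) :
    rainbowParity N h l (fun _ => True) =
      rainbowParity N h l P + rainbowParity N h l (fun v => ¬ P v) := by
  classical
  simp only [rainbowParity]
  rw [← Finset.sum_add_distrib]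
  refine Finset.sum_congr rfl fun τ hτ => ?_
  by_cases hr : ∀ a, ∃ j, j ≠ 4 ∧ l (vertex τ j) = a
  · have h04 : ∃ j : Fin 5, j ≠ 4 := ⟨0, by decide⟩
    rcases hP τ hτ (fun a => (hr a).imp fun j hj => hj.2) with h | h <;>
      simp [IsRainbow, h, h04]
  · have : ∀ P, ¬ IsRainbow l P τ 4 := fun P h => hr h.1
    simp [this]

/-- An equivariant labelling of cyclically ordered quadruples together with a sign that is
reversed by the cyclic shift has a simplex with all labels and both signs. -/
theorem exists_rainbow_simplex_mixed_sign {N : ℤ} (hN : 4 ≤ N)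
    (Good : (Fin 4 → ℤ) → Fin 4 → Prop) (Pos Neg : (Fin 4 → ℤ) → Prop)
    (hex : ∀ v, IsCyclicallyOrdered N v → ∃ a, Good v a)
    (hgap : ∀ v a, IsCyclicallyOrdered N v → Good v a → v a < cyclicShift N v a)
    (hshift : ∀ v a, IsCyclicallyOrdered N v → Good v a → Good (cyclicShift N v) (a - 1))
    (hsign : ∀ v, Pos v ∨ Neg v) (hpos : ∀ v, Pos v → Neg (cyclicShift N v))
    (hneg : ∀ v, Neg v → Pos (cyclicShift N v)) :
    ∃ h, 0 ≤ h ∧ h < N ∧ ∃ τ ∈ cyclicSimplices N h, (∀ a, ∃ j, Good (vertex τ j) a) ∧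
      (∃ j, Pos (vertex τ j)) ∧ ∃ j, Neg (vertex τ j) := by
  classical
  choose! f hf using hex
  set l : (Fin 4 → ℤ) → Fin 4 :=
    fun v => if ∑ a, v a < N then f v else f (cyclicUnshift N v) - 1 with hl
  set P : (Fin 4 → ℤ) → Prop :=
    fun v => if ∑ a, v a < N then Pos v else ¬ Pos (cyclicUnshift N v) with hP
  have hgood : ∀ v, IsCyclicallyOrdered N v → Good v (l v) := by
    intro v hv
    simp only [hl]
    split_ifs
    · exact hf v hv
    · rw [← cyclicShift_cyclicUnshift N v, isCyclicallyOrdered_cyclicShift] at hv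
      simpa only [cyclicShift_cyclicUnshift] using hshift _ _ hv (hf _ hv)
  have hPpos : ∀ v, P v → Pos v := by
    intro v hv
    simp only [hP] at hv
    split_ifs at hv
    · exact hv
    · rw [← cyclicShift_cyclicUnshift N v]
      exact hneg _ ((hsign _).resolve_left hv)
  have hPneg : ∀ v, ¬ P v → Neg v := by
    intro v hv
    simp only [hP] at hv
    split_ifs at hv
    · exact (hsign v).resolve_left hv
    · rw [← cyclicShift_cyclicUnshift N v]
      exact hpos _ (not_not.1 hv)
  by_contra! hcon
  have hsame : ∀ m, 0 ≤ m → m < N → ∀ τ ∈ cyclicSimplices N m,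
      (∀ a, ∃ j, l (vertex τ j) = a) → (∀ j, P (vertex τ j)) ∨ ∀ j, ¬ P (vertex τ j) := by
    intro m h0 hm τ hτ hall
    by_contra! hmix
    obtain ⟨⟨i, hi⟩, j, hj⟩ := hmix
    refine hcon m h0 hm τ hτ (fun a => ?_) ⟨j, hPpos _ hj⟩ i (hPneg _ hi)
    obtain ⟨j, rfl⟩ := hall a
    exact ⟨j, hgood _ ((mem_cyclicSimplices.1 hτ).2 j)⟩
  have hface : ∀ v, IsCyclicallyOrdered N v → v (l v) < cyclicShift N v (l v) :=
    fun v hv => hgap v _ hv (hgood v hv)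
  have h1 := rainbowParity_zero (by omega) hface
  rw [rainbowParity_split (hsame 0 le_rfl (by omega))] at h1
  have h2 : rainbowParity N (0 + N) l P = rainbowParity N 0 l P := by
    have := rainbowParity_add (P := P) (h := 0) hface N.toNat
      (fun m h0 hm => hsame m h0 (by omega))
    rwa [Int.toNat_of_nonneg (by omega)] at this
  have h3 : rainbowParity N (0 + N) l P = rainbowParity N 0 l (fun v => ¬ P v) := by
    rw [rainbowParity_add_period, ← rainbowParity_perm (Equiv.subRight 1) (l := l)]
    refine rainbowParity_congr (fun v h0 h3 => ?_) (fun v h0 h3 => ?_)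
    · have h4 : ∑ a, v a < N := by omega
      have h5 : ¬ ∑ a, cyclicShift N v a < N := by rw [sum_cyclicShift]; omega
      simp only [hl, if_pos h4, if_neg h5, cyclicUnshift_cyclicShift, Equiv.subRight_apply]
    · have h4 : ∑ a, v a < N := by omega
      have h5 : ¬ ∑ a, cyclicShift N v a < N := by rw [sum_cyclicShift]; omega
      simp only [hP, if_pos h4, if_neg h5, cyclicUnshift_cyclicShift]
  rw [← h3, h2, CharTwo.add_self_eq_zero] at h1
  exact zero_ne_one h1

/-- The cyclic successor map on lifts of quadruples of points of `ℝ / ℤ`. -/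
noncomputable def nextParam (x : Fin 4 → ℝ) : Fin 4 → ℝ :=
  fun a => x (a + 1) + if a = 3 then 1 else 0

/-- The length of the side of an inscribed quadrilateral starting at the vertex `a`. -/
noncomputable def sideLength {E : Type*} [NormedAddCommGroup E] (γ : ℝ → E) (x : Fin 4 → ℝ)
    (a : Fin 4) : ℝ :=
  ‖γ (x a) - γ (nextParam x a)‖

/-- The difference of the diagonals of an inscribed quadrilateral. -/
noncomputable def diagonalDefect {E : Type*} [NormedAddCommGroup E] (γ : ℝ → E)
    (x : Fin 4 → ℝ) : ℝ :=
  ‖γ (x 0) - γ (x 2)‖ - ‖γ (x 1) - γ (x 3)‖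

/-- The side starting at `a` is longest, and has the largest parameter gap among such sides. -/
def IsLongestSide {E : Type*} [NormedAddCommGroup E] (γ : ℝ → E) (x : Fin 4 → ℝ)
    (a : Fin 4) : Prop :=
  ∀ b, sideLength γ x b ≤ sideLength γ x a ∧
    (sideLength γ x b = sideLength γ x a → nextParam x b - x b ≤ nextParam x a - x a)

section Inscribed

variable {E : Type*} [NormedAddCommGroup E] {γ : ℝ → E}

lemma exists_isLongestSide (γ : ℝ → E) (x : Fin 4 → ℝ) : ∃ a, IsLongestSide γ x a := by
  obtain ⟨a, ha⟩ := Finite.exists_max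
    (fun a => toLex (sideLength γ x a, nextParam x a - x a))
  refine ⟨a, fun b => ?_⟩
  have := Prod.Lex.le_iff.1 (ha b)
  simp at this
  grind

lemma sum_gap (x : Fin 4 → ℝ) : ∑ a, (nextParam x a - x a) = 1 := by
  simp [nextParam, Fin.sum_univ_four]
  ring

lemma nextParam_sub_one (x : Fin 4 → ℝ) (a : Fin 4) :
    nextParam x (a - 1) = x a + if a = 0 then 1 else 0 := by
  have : a - 1 = 3 ↔ a = 0 := by revert a; decide
  simp [nextParam, this]

lemma nextParam_nextParam_sub_one (x : Fin 4 → ℝ) (a : Fin 4) :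
    nextParam (nextParam x) (a - 1) = nextParam x a + if a = 0 then 1 else 0 :=
  nextParam_sub_one _ a

lemma sideLength_nextParam (hper : Function.Periodic γ 1) (x : Fin 4 → ℝ) (a : Fin 4) :
    sideLength γ (nextParam x) (a - 1) = sideLength γ x a := by
  rw [sideLength, sideLength, nextParam_nextParam_sub_one, nextParam_sub_one]
  split_ifs
  · rw [hper, hper]
  · simp

lemma diagonalDefect_nextParam (hper : Function.Periodic γ 1) (x : Fin 4 → ℝ) :
    diagonalDefect γ (nextParam x) = -diagonalDefect γ x := by
  simp [diagonalDefect, nextParam, hper (x 0)]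
  rw [norm_sub_rev (γ (x 2))]

lemma IsLongestSide.nextParam (hper : Function.Periodic γ 1) {x : Fin 4 → ℝ} {a : Fin 4}
    (h : IsLongestSide γ x a) : IsLongestSide γ (nextParam x) (a - 1) := by
  intro b
  obtain ⟨c, rfl⟩ : ∃ c, b = c - 1 := ⟨b + 1, by simp⟩
  simpa only [sideLength_nextParam hper, nextParam_nextParam_sub_one, nextParam_sub_one,
    add_sub_add_right_eq_sub] using h c

lemma IsLongestSide.lt_nextParam {x : Fin 4 → ℝ} {a : Fin 4} (hx : x ≤ _root_.nextParam x)
    (h : IsLongestSide γ x a) : x a < _root_.nextParam x a := by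
  by_contra! hle
  have heq : x a = _root_.nextParam x a := le_antisymm (hx a) hle
  have h0 : sideLength γ x a = 0 := by rw [sideLength, ← heq, sub_self, norm_zero]
  have hgap : ∀ b, _root_.nextParam x b - x b ≤ 0 := by
    intro b
    rw [← sub_eq_zero.2 heq.symm]
    exact (h b).2 (le_antisymm (h b).1 (h0 ▸ norm_nonneg _))
  have := sum_gap x
  linarith [Finset.sum_nonpos fun b (_ : b ∈ Finset.univ) => hgap b]

lemma nextParam_div {N : ℤ} (hN : N ≠ 0) (v : Fin 4 → ℤ) :
    nextParam (fun a => (v a : ℝ) / N) = fun a => (cyclicShift N v a : ℝ) / N := by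
  have hN' : (N : ℝ) ≠ 0 := by exact_mod_cast hN
  ext a
  simp only [nextParam, cyclicShift]
  split_ifs
  · push_cast
    field_simp
  · simp

lemma exists_near_longest_sides (hper : Function.Periodic γ 1) (n : ℕ) :
    ∃ x : Fin 4 → ℝ, (x ∈ Set.Icc (fun _ => -1) (fun _ => 2)) ∧
      (∀ a, ∃ y, dist y x ≤ 1 / ((n : ℝ) + 1) ∧ y ≤ nextParam y ∧ IsLongestSide γ y a) ∧
      (∃ y, dist y x ≤ 1 / ((n : ℝ) + 1) ∧ 0 ≤ diagonalDefect γ y) ∧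
      ∃ y, dist y x ≤ 1 / ((n : ℝ) + 1) ∧ diagonalDefect γ y ≤ 0 := by
  set N : ℤ := n + 4 with hN
  have hN0 : N ≠ 0 := by omega
  have hNpos : (0 : ℝ) < N := by exact_mod_cast (by omega : 0 < N)
  set s : (Fin 4 → ℤ) → Fin 4 → ℝ := fun v a => (v a : ℝ) / N with hs
  have hord : ∀ v, IsCyclicallyOrdered N v → s v ≤ nextParam (s v) := by
    intro v hv a
    rw [hs, nextParam_div hN0]
    have := hv a
    simp only
    gcongr
  obtain ⟨h, h0, hlt, τ, hτ, hall, ⟨i, hi⟩, j, hj⟩ := exists_rainbow_simplex_mixed_sign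
    (N := N) (by omega) (fun v a => IsLongestSide γ (s v) a) (fun v => 0 ≤ diagonalDefect γ (s v))
    (fun v => diagonalDefect γ (s v) ≤ 0) (fun v _ => exists_isLongestSide γ _)
    (fun v a hv ha => by
      have := ha.lt_nextParam (hord v hv)
      rw [hs, nextParam_div hN0] at this
      exact_mod_cast (div_lt_div_iff_of_pos_right hNpos).1 this)
    (fun v a _ ha => by
      have := ha.nextParam hper
      rwa [hs, nextParam_div hN0] at this)
    (fun v => le_total _ _)
    (fun v hv => by
      have := diagonalDefect_nextParam hper (s v)
      rw [hs, nextParam_div hN0] at this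
      simp only [hs] at hv ⊢
      linarith)
    (fun v hv => by
      have := diagonalDefect_nextParam hper (s v)
      rw [hs, nextParam_div hN0] at this
      simp only [hs] at hv ⊢
      linarith)
  obtain ⟨hsum, hcyc⟩ := mem_cyclicSimplices.1 hτ
  have hdist : ∀ j, dist (s (vertex τ j)) (s τ.1) ≤ 1 / ((n : ℝ) + 1) := by
    intro j
    rw [dist_pi_le_iff (by positivity)]
    intro a
    have hNn : (N : ℝ) = n + 4 := by rw [hN]; push_cast; rfl
    have hle : 1 / (N : ℝ) ≤ 1 / ((n : ℝ) + 1) := by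
      apply one_div_le_one_div_of_le (by positivity)
      rw [hNn]; linarith
    refine le_trans ?_ hle
    simp only [hs, Real.dist_eq, ← sub_div, vertex]
    rw [abs_div, abs_of_pos hNpos]
    gcongr
    split_ifs <;> simp
  refine ⟨s τ.1, ?_, fun a => ?_, ⟨_, hdist i, hi⟩, ⟨_, hdist j, hj⟩⟩
  · have hc := isCyclicallyOrdered_iff.1 (hcyc 0)
    rw [vertex_zero] at hc
    rw [Fin.sum_univ_four] at hsum
    have hb : ∀ a, -1 * N ≤ τ.1 a ∧ τ.1 a ≤ 2 * N := by
      simp only [Fin.forall_fin_succ, Fin.succ_zero_eq_one, IsEmpty.forall_iff, and_true]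
      simp
      omega
    refine ⟨fun a => ?_, fun a => ?_⟩
    · simp only [hs]
      rw [le_div_iff₀ hNpos]
      exact_mod_cast (hb a).1
    · simp only [hs]
      rw [div_le_iff₀ hNpos]
      exact_mod_cast (hb a).2
  · obtain ⟨j, hj⟩ := hall a
    exact ⟨_, hdist j, hord _ (hcyc j), hj⟩

lemma continuous_nextParam : Continuous nextParam := by
  unfold nextParam
  fun_prop

lemma continuous_sideLength (hγ : Continuous γ) (a : Fin 4) :
    Continuous fun x => sideLength γ x a := by
  have := continuous_nextParam
  unfold sideLength
  fun_prop

lemma continuous_diagonalDefect (hγ : Continuous γ) : Continuous (diagonalDefect γ) := by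
  unfold diagonalDefect
  fun_prop

lemma sideLength_le_of_gap_large (hper : Function.Periodic γ 1) {δ : ℝ}
    (hloc : ∀ u p q w, u ≤ p → p ≤ q → q ≤ w → w < u + δ → ‖γ q - γ p‖ ≤ ‖γ w - γ u‖)
    {x : Fin 4 → ℝ} (hx : x ≤ nextParam x) {c : Fin 4} (hc : 1 - δ < nextParam x c - x c)
    (a : Fin 4) : sideLength γ x a ≤ sideLength γ x c := by
  have h := fun a => hx a
  simp only [nextParam, Fin.forall_fin_succ, IsEmpty.forall_iff, and_true] at h
  simp at h
  have key : ∀ p q, nextParam x c ≤ p → p ≤ q → q ≤ x c + 1 →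
      ‖γ p - γ q‖ ≤ sideLength γ x c := by
    intro p q hp hpq hq
    rw [norm_sub_rev, sideLength, ← hper (x c)]
    exact hloc _ _ _ _ hp hpq hq (by linarith)
  by_cases hac : a = c
  · rw [hac]
  by_cases hlt : c < a
  · refine key (x a) (nextParam x a) ?_ (hx a) ?_ <;>
      fin_cases a <;> fin_cases c <;> simp [nextParam] at * <;> linarith
  · have e : sideLength γ x a = ‖γ (x a + 1) - γ (nextParam x a + 1)‖ := by
      rw [hper, hper, sideLength]
    rw [e]
    have := hx a
    refine key _ _ ?_ (by linarith) ?_ <;>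
      fin_cases a <;> fin_cases c <;> simp [nextParam] at * <;> linarith

/-- A simple closed curve without local backtracking inscribes a cyclically ordered quadrilateral
with equal sides and equal diagonals. -/
theorem exists_inscribed_equal_sides_equal_diagonals (hγ : Continuous γ)
    (hper : Function.Periodic γ 1) (hinj : ∀ s t, γ s = γ t → ∃ k : ℤ, s - t = k) {δ : ℝ}
    (hδ : 0 < δ)
    (hloc : ∀ u p q w, u ≤ p → p ≤ q → q ≤ w → w < u + δ → ‖γ q - γ p‖ ≤ ‖γ w - γ u‖) :
    ∃ x : Fin 4 → ℝ, (∀ a, x a < nextParam x a) ∧ (∀ a, 0 < sideLength γ x a) ∧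
      (∀ a b, sideLength γ x a = sideLength γ x b) ∧ diagonalDefect γ x = 0 := by
  choose x hxK hy hp hq using exists_near_longest_sides (γ := γ) hper
  choose y hyd hyord hylong using hy
  choose p hpd hp using hp
  choose q hqd hq using hq
  obtain ⟨z, -, φ, hφ, hz⟩ := isCompact_Icc.tendsto_subseq hxK
  have hnear : ∀ u : ℕ → Fin 4 → ℝ, (∀ n, dist (u n) (x n) ≤ 1 / ((n : ℝ) + 1)) →
      Filter.Tendsto (fun n => u (φ n)) Filter.atTop (nhds z) := by
    intro u hu
    refine (tendsto_iff_of_dist ?_).2 hz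
    exact squeeze_zero (fun _ => dist_nonneg) (fun n => hu (φ n))
      (tendsto_one_div_add_atTop_nhds_zero_nat.comp hφ.tendsto_atTop)
  have hya : ∀ a, Filter.Tendsto (fun n => y (φ n) a) Filter.atTop (nhds z) :=
    fun a => hnear (fun n => y n a) fun n => hyd n a
  have hord : z ≤ nextParam z :=
    le_of_tendsto_of_tendsto' (hya 0) ((continuous_nextParam.tendsto z).comp (hya 0))
      fun n => hyord (φ n) 0
  have hle : ∀ a b, sideLength γ z b ≤ sideLength γ z a := fun a b =>
    le_of_tendsto_of_tendsto' (((continuous_sideLength hγ b).tendsto z).comp (hya a))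
      (((continuous_sideLength hγ a).tendsto z).comp (hya a)) fun n => (hylong (φ n) a b).1
  have hside : ∀ a b, sideLength γ z a = sideLength γ z b := fun a b => (hle b a).antisymm (hle a b)
  have hdiag : diagonalDefect γ z = 0 :=
    le_antisymm
      (le_of_tendsto' (((continuous_diagonalDefect hγ).tendsto z).comp (hnear q hqd))
        fun n => hq (φ n))
      (ge_of_tendsto' (((continuous_diagonalDefect hγ).tendsto z).comp (hnear p hpd))
        fun n => hp (φ n))
  have hne : ∀ a, sideLength γ z a ≠ 0 := by
    intro a₀ ha₀
    have hint : ∀ a, ∃ k : ℤ, nextParam z a - z a = k := by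
      intro a
      refine hinj _ _ ?_
      rw [hside a₀ a, sideLength, norm_eq_zero, sub_eq_zero] at ha₀
      exact ha₀.symm
    obtain ⟨c, hc⟩ : ∃ c, 0 < nextParam z c - z c := by
      by_contra! hcon
      have := sum_gap z
      linarith [Finset.sum_nonpos fun b (_ : b ∈ Finset.univ) => hcon b]
    have hc1 : 1 ≤ nextParam z c - z c := by
      obtain ⟨k, hk⟩ := hint c
      rw [hk] at hc ⊢
      exact_mod_cast hc
    obtain ⟨a, hac⟩ := exists_ne c
    have hgap : Filter.Tendsto (fun n => nextParam (y (φ n) a) c - y (φ n) a c) Filter.atTop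
        (nhds (nextParam z c - z c)) :=
      ((((continuous_apply c).comp continuous_nextParam).sub (continuous_apply c)).tendsto z).comp
        (hya a)
    obtain ⟨n, hn⟩ := (hgap.eventually (lt_mem_nhds
      (show max (1 - δ) (1 / 2) < nextParam z c - z c from
        lt_of_lt_of_le (max_lt (by linarith) (by norm_num)) hc1))).exists
    rw [max_lt_iff] at hn
    have hs := sideLength_le_of_gap_large hper hloc (hyord (φ n) a) hn.1 a
    have hg := (hylong (φ n) a c).2 (le_antisymm (hylong (φ n) a c).1 hs)
    have hsum := Finset.add_le_sum
      (f := fun b => nextParam (y (φ n) a) b - y (φ n) a b)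
      (fun b _ => sub_nonneg.2 (hyord (φ n) a b)) (Finset.mem_univ a) (Finset.mem_univ c) hac
    rw [sum_gap] at hsum
    linarith [hn.2]
  have hpos : ∀ a, 0 < sideLength γ z a := fun a => (norm_nonneg _).lt_of_ne' (hne a)
  refine ⟨z, fun a => (hord a).lt_of_ne fun h => hne a ?_, hpos, hside, hdiag⟩
  rw [sideLength, ← h, sub_self, norm_zero]

end Inscribed

lemma sq_diagonal_of_rhombus {a₀ a₁ b₀ b₁ c₀ c₁ d₀ d₁ s : ℝ}
    (hab : (a₀ - b₀) ^ 2 + (a₁ - b₁) ^ 2 = s) (hbc : (b₀ - c₀) ^ 2 + (b₁ - c₁) ^ 2 = s)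
    (hcd : (c₀ - d₀) ^ 2 + (c₁ - d₁) ^ 2 = s) (hda : (d₀ - a₀) ^ 2 + (d₁ - a₁) ^ 2 = s)
    (hdiag : (a₀ - c₀) ^ 2 + (a₁ - c₁) ^ 2 = (b₀ - d₀) ^ 2 + (b₁ - d₁) ^ 2)
    (hac : (a₀ - c₀) ^ 2 + (a₁ - c₁) ^ 2 ≠ 0) :
    (a₀ - c₀) ^ 2 + (a₁ - c₁) ^ 2 = 2 * s := by
  set m₀ := a₀ + c₀ - b₀ - d₀ with hm₀
  set m₁ := a₁ + c₁ - b₁ - d₁ with hm₁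
  have huv : (a₀ - c₀) * (b₀ - d₀) + (a₁ - c₁) * (b₁ - d₁) = 0 := by linarith
  have hmu : m₀ * (a₀ - c₀) + m₁ * (a₁ - c₁) = 0 := by rw [hm₀, hm₁]; linarith
  have hmv : m₀ * (b₀ - d₀) + m₁ * (b₁ - d₁) = 0 := by rw [hm₀, hm₁]; linarith
  have hcross : (a₀ - c₀) * (b₁ - d₁) - (a₁ - c₁) * (b₀ - d₀) ≠ 0 := by
    intro h
    apply hac
    have : ((a₀ - c₀) ^ 2 + (a₁ - c₁) ^ 2) * ((b₀ - d₀) ^ 2 + (b₁ - d₁) ^ 2) = 0 := by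
      linear_combination
        ((a₀ - c₀) * (b₁ - d₁) - (a₁ - c₁) * (b₀ - d₀)) * h +
        ((a₀ - c₀) * (b₀ - d₀) + (a₁ - c₁) * (b₁ - d₁)) * huv
    rw [← hdiag] at this
    exact mul_self_eq_zero.1 this
  have h₀ : m₀ = 0 := by
    refine (mul_eq_zero.1 ?_).resolve_right hcross
    linear_combination (b₁ - d₁) * hmu - (a₁ - c₁) * hmv
  have h₁ : m₁ = 0 := by
    refine (mul_eq_zero.1 ?_).resolve_right hcross
    linear_combination (a₀ - c₀) * hmv - (b₀ - d₀) * hmu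
  have e₀ : d₀ = a₀ + c₀ - b₀ := by linarith
  have e₁ : d₁ = a₁ + c₁ - b₁ := by linarith
  subst e₀ e₁
  linarith

/-- A planar quadrilateral with equal sides and equal nonzero diagonals is a square. -/
lemma norm_diagonal_of_rhombus {A B C D : EuclideanSpace ℝ (Fin 2)} (hbc : ‖A - B‖ = ‖B - C‖)
    (hcd : ‖B - C‖ = ‖C - D‖) (hda : ‖C - D‖ = ‖D - A‖) (hdiag : ‖A - C‖ = ‖B - D‖)
    (hac : A ≠ C) : ‖A - C‖ = Real.sqrt 2 * ‖A - B‖ := by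
  have hsq : ∀ P Q : EuclideanSpace ℝ (Fin 2),
      (P 0 - Q 0) ^ 2 + (P 1 - Q 1) ^ 2 = ‖P - Q‖ ^ 2 := by
    intro P Q
    simp [EuclideanSpace.real_norm_sq_eq]
  have key := sq_diagonal_of_rhombus (s := ‖A - B‖ ^ 2) (hsq A B) ((hsq B C).trans (by rw [hbc]))
    ((hsq C D).trans (by rw [hbc, hcd])) ((hsq D A).trans (by rw [hbc, hcd, hda]))
    ((hsq A C).trans ((hsq B D).trans (by rw [hdiag])).symm)
    (by rw [hsq]; exact pow_ne_zero 2 (norm_ne_zero_iff.2 (sub_ne_zero.2 hac)))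
  rw [hsq] at key
  rw [← sq_eq_sq₀ (norm_nonneg _) (by positivity), mul_pow, Real.sq_sqrt (by norm_num), key]

section Regular

variable {E : Type*} [NormedAddCommGroup E] [InnerProductSpace ℝ E] {γ : ℝ → E}

/-- A continuous periodic nowhere vanishing function makes acute angles at nearby points. -/
lemma exists_inner_nonneg_of_periodic {f : ℝ → E} (hf : Continuous f)
    (hper : Function.Periodic f 1) (hne : ∀ t, f t ≠ 0) :
    ∃ δ > 0, ∀ s t, |s - t| < δ → 0 ≤ inner ℝ (f s) (f t) := by
  obtain ⟨t₀, -, ht₀⟩ := isCompact_Icc.exists_isMinOn (Set.nonempty_Icc.2 zero_le_one)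
    hf.norm.continuousOn (s := Set.Icc (0 : ℝ) 1)
  have hmin : ∀ t, ‖f t₀‖ ≤ ‖f t‖ := by
    intro t
    obtain ⟨u, hu, hu'⟩ := hper.exists_mem_Ico₀ one_pos t
    rw [hu']
    exact ht₀ (Set.Ico_subset_Icc_self hu)
  have huc : UniformContinuousOn f (Set.Icc (-1) 2) :=
    isCompact_Icc.uniformContinuousOn_of_continuous hf.continuousOn
  obtain ⟨δ, hδ, h⟩ := Metric.uniformContinuousOn_iff.1 huc _ (norm_pos_iff.2 (hne t₀))
  refine ⟨min δ 1, by positivity, fun s t hst => ?_⟩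
  rw [lt_min_iff, abs_lt, abs_lt] at hst
  have hf0 := Int.fract_nonneg s
  have hf1 := (Int.fract_lt_one s).le
  have hs : f (s - ⌊s⌋) = f s := by simpa using hper.sub_int_mul_eq ⌊s⌋ (x := s)
  have ht : f (t - ⌊s⌋) = f t := by simpa using hper.sub_int_mul_eq ⌊s⌋ (x := t)
  have hd := h (s - ⌊s⌋) (by rw [Int.self_sub_floor]; constructor <;> linarith) (t - ⌊s⌋)
    (by rw [Int.fract] at hf0 hf1; constructor <;> linarith [hst.2.1, hst.2.2])
    (by rw [Real.dist_eq, abs_lt]; constructor <;> linarith [hst.1.1, hst.1.2])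
  rw [hs, ht, dist_eq_norm] at hd
  have h1 := norm_sub_sq_real (f s) (f t)
  have h2 := hmin t
  have h3 : ‖f s - f t‖ ^ 2 ≤ ‖f t‖ ^ 2 := by gcongr; linarith
  nlinarith [sq_nonneg ‖f s‖]

/-- Chords of a curve whose velocity turns by at most a right angle grow with their arcs. -/
lemma norm_chord_le {γ' : ℝ → E} (hγ : ∀ t, HasDerivAt γ (γ' t) t) {u w : ℝ}
    (hin : ∀ s ∈ Set.Icc u w, ∀ t ∈ Set.Icc u w, 0 ≤ inner ℝ (γ' s) (γ' t)) {p q : ℝ}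
    (hup : u ≤ p) (hpq : p ≤ q) (hqw : q ≤ w) : ‖γ q - γ p‖ ≤ ‖γ w - γ u‖ := by
  have hchord : ∀ t ∈ Set.Icc u w,
      MonotoneOn (fun s => inner ℝ (γ s) (γ' t)) (Set.Icc u w) := by
    intro t ht
    have hd : ∀ s, HasDerivAt (fun s => inner ℝ (γ s) (γ' t)) (inner ℝ (γ' s) (γ' t)) s := by
      intro s
      simpa using (hγ s).inner ℝ (hasDerivAt_const s (γ' t))
    exact monotoneOn_of_hasDerivWithinAt_nonneg (convex_Icc u w)
      (fun s _ => (hd s).continuousAt.continuousWithinAt) (fun s _ => (hd s).hasDerivWithinAt)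
      fun s hs => hin s (interior_subset hs) t ht
  have hsq : ∀ c s, HasDerivAt (fun s => ‖γ s - c‖ ^ 2) (2 * inner ℝ (γ s - c) (γ' s)) s :=
    fun c s => ((hγ s).sub_const c).norm_sq
  have h1 : ‖γ q - γ p‖ ^ 2 ≤ ‖γ w - γ p‖ ^ 2 := by
    refine monotoneOn_of_hasDerivWithinAt_nonneg (convex_Icc p w)
      (fun s _ => (hsq (γ p) s).continuousAt.continuousWithinAt)
      (fun s _ => (hsq (γ p) s).hasDerivWithinAt) (fun s hs => ?_) ⟨hpq, hqw⟩
      ⟨hpq.trans hqw, le_rfl⟩ hqw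
    have hs' := interior_subset hs
    have := hchord s ⟨hup.trans hs'.1, hs'.2⟩ ⟨hup, hpq.trans hqw⟩ ⟨hup.trans hs'.1, hs'.2⟩ hs'.1
    simp only at this
    rw [inner_sub_left]
    linarith
  have h2 : ‖γ p - γ w‖ ^ 2 ≤ ‖γ u - γ w‖ ^ 2 := by
    refine antitoneOn_of_hasDerivWithinAt_nonpos (convex_Icc u w)
      (fun s _ => (hsq (γ w) s).continuousAt.continuousWithinAt)
      (fun s _ => (hsq (γ w) s).hasDerivWithinAt) (fun s hs => ?_)
      ⟨le_rfl, hup.trans (hpq.trans hqw)⟩ ⟨hup, hpq.trans hqw⟩ hup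
    have hs' := interior_subset hs
    have := hchord s hs' hs' ⟨hup.trans (hpq.trans hqw), le_rfl⟩ hs'.2
    simp only at this
    rw [inner_sub_left]
    linarith
  rw [norm_sub_rev (γ p), norm_sub_rev (γ u)] at h2
  exact (sq_le_sq₀ (norm_nonneg _) (norm_nonneg _)).1 (h1.trans h2)

end Regular

/-- Every `C²`-smooth embedded closed curve in the plane has
an inscribed square: four distinct points in cyclic order on the curve with
equal positive sides and equal diagonals of length `√2` times the side. -/
theorem c2_curve_has_inscribed_square (γ : ℝ → EuclideanSpace ℝ (Fin 2))
    (hper : Function.Periodic γ 1) (hsmooth : ContDiff ℝ 2 γ)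
    (hreg : ∀ t : ℝ, deriv γ t ≠ 0)
    (hemb : ∀ x ∈ Set.Ico (0:ℝ) 1, ∀ y ∈ Set.Ico (0:ℝ) 1, γ x = γ y → x = y) :
    ∃ t₁ t₂ t₃ t₄ : ℝ, t₁ < t₂ ∧ t₂ < t₃ ∧ t₃ < t₄ ∧ t₄ < t₁ + 1 ∧
      0 < ‖γ t₁ - γ t₂‖ ∧
      ‖γ t₁ - γ t₂‖ = ‖γ t₂ - γ t₃‖ ∧
      ‖γ t₂ - γ t₃‖ = ‖γ t₃ - γ t₄‖ ∧
      ‖γ t₃ - γ t₄‖ = ‖γ t₄ - γ t₁‖ ∧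
      ‖γ t₁ - γ t₃‖ = ‖γ t₂ - γ t₄‖ ∧
      ‖γ t₁ - γ t₃‖ = Real.sqrt 2 * ‖γ t₁ - γ t₂‖ := by
  have hdiff : ∀ t, HasDerivAt γ (deriv γ t) t := fun t =>
    (hsmooth.differentiable (by norm_num) t).hasDerivAt
  have hder : Function.Periodic (deriv γ) 1 := fun t => by
    have h := deriv_comp_add_const γ 1 t
    rw [← h]
    exact congrArg (fun f => deriv f t) (funext hper)
  obtain ⟨δ, hδ, hin⟩ := exists_inner_nonneg_of_periodic
    (hsmooth.continuous_deriv (by norm_num)) hder hreg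
  have hinj : ∀ s t, γ s = γ t → ∃ k : ℤ, s - t = k := by
    intro s t hst
    have hfract : ∀ r, γ (Int.fract r) = γ r := fun r => by
      rw [Int.fract, ← mul_one (⌊r⌋ : ℝ)]
      exact hper.sub_int_mul_eq ⌊r⌋
    have := hemb (Int.fract s) ⟨Int.fract_nonneg s, Int.fract_lt_one s⟩ (Int.fract t)
      ⟨Int.fract_nonneg t, Int.fract_lt_one t⟩ (by rw [hfract, hfract, hst])
    exact Int.fract_eq_fract.1 this
  obtain ⟨x, hlt, hpos, hside, hdiag⟩ := exists_inscribed_equal_sides_equal_diagonals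
    hsmooth.continuous hper hinj hδ (fun u p q w hup hpq hqw hwu =>
      norm_chord_le hdiff (fun s hs t ht => hin s t (by
        rw [abs_lt]; constructor <;> linarith [hs.1, hs.2, ht.1, ht.2])) hup hpq hqw)
  have h01 : x 0 < x 1 := by simpa [nextParam] using hlt 0
  have h12 : x 1 < x 2 := by simpa [nextParam] using hlt 1
  have h23 : x 2 < x 3 := by simpa [nextParam] using hlt 2
  have h30 : x 3 < x 0 + 1 := by simpa [nextParam] using hlt 3
  have e0 : 0 < ‖γ (x 0) - γ (x 1)‖ := by simpa [sideLength, nextParam] using hpos 0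
  have e1 : ‖γ (x 0) - γ (x 1)‖ = ‖γ (x 1) - γ (x 2)‖ := by
    simpa [sideLength, nextParam] using hside 0 1
  have e2 : ‖γ (x 1) - γ (x 2)‖ = ‖γ (x 2) - γ (x 3)‖ := by
    simpa [sideLength, nextParam] using hside 1 2
  have e3 : ‖γ (x 2) - γ (x 3)‖ = ‖γ (x 3) - γ (x 0)‖ := by
    simpa [sideLength, nextParam, hper (x 0)] using hside 2 3
  have e4 : ‖γ (x 0) - γ (x 2)‖ = ‖γ (x 1) - γ (x 3)‖ := sub_eq_zero.1 hdiag
  refine ⟨x 0, x 1, x 2, x 3, h01, h12, h23, h30, e0, e1, e2, e3, e4,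
    norm_diagonal_of_rhombus e1 e2 e3 e4 fun h => ?_⟩
  obtain ⟨k, hk⟩ := hinj _ _ h
  have hk0 : (k : ℝ) < 0 := by linarith
  have hk1 : (-1 : ℝ) < k := by linarith
  norm_cast at hk0 hk1
  omega
end
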